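/- arXiv:0906.0895 — 3 statements merged into one kernel-verified Lean document; each statement's English description precedes it below -/
import Mathlib

section
/- Let G be a 3-γ-vertex-critical graph of even order with |V(G)| ≠ 12. If G is K_{1,6}-free, then G has a perfect matching. -/
open SimpleGraph

/-- `D` is a dominating set of `G`: every vertex is in `D` or adjacent to a vertex of `D`. -/
def IsDomSet {V : Type*} (G : SimpleGraph V) (D : Set V) : Prop :=
  ∀ v, v ∈ D ∨ ∃ u ∈ D, G.Adj u v

/-- The domination number `γ(G)`. -/
noncomputable def domNum {V : Type*} (G : SimpleGraph V) : ℕ :=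
  sInf {n | ∃ D : Set V, IsDomSet G D ∧ D.ncard = n}

/-- `D` is a dominating set of the vertex-deleted graph `G - x`. -/
def IsDomSetAvoiding {V : Type*} (G : SimpleGraph V) (x : V) (D : Set V) : Prop :=
  x ∉ D ∧ ∀ v, v ≠ x → v ∈ D ∨ ∃ u ∈ D, G.Adj u v

/-- The domination number of the vertex-deleted graph `G - x`. -/
noncomputable def domNumDel {V : Type*} (G : SimpleGraph V) (x : V) : ℕ :=
  sInf {n | ∃ D : Set V, IsDomSetAvoiding G x D ∧ D.ncard = n}

/-- `G` is `k`-`γ`-vertex-critical: `γ(G) = k` and `γ(G - v) < k` for every vertex `v`. -/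
def GammaCritical {V : Type*} (G : SimpleGraph V) (k : ℕ) : Prop :=
  domNum G = k ∧ ∀ v : V, domNumDel G v < k

/-- `G` is `K_{1,n}`-free: it has no induced subgraph isomorphic to the star `K_{1,n}`. -/
def StarFree {V : Type*} (G : SimpleGraph V) (n : ℕ) : Prop :=
  ¬ ∃ (c : V) (T : Finset V), T.card = n ∧ (∀ t ∈ T, G.Adj c t) ∧
      ∀ t ∈ T, ∀ t' ∈ T, t ≠ t' → ¬ G.Adj t t'

/-- `G` has a perfect matching. -/
def HasPerfectMatching {V : Type*} (G : SimpleGraph V) : Prop :=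
  ∃ M : G.Subgraph, M.IsPerfectMatching

/-- `G` has a near perfect matching: a matching covering all but exactly one vertex. -/
def HasNearPerfectMatching {V : Type*} (G : SimpleGraph V) : Prop :=
  ∃ (M : G.Subgraph) (v : V), M.IsMatching ∧ M.verts = {v}ᶜ

/-- `c_o(G - S)`: the number of odd components of `G - S`. -/
noncomputable def numOddComponents {V : Type*} (G : SimpleGraph V) (S : Set V) : ℕ :=
  Nat.card {c : (G.induce Sᶜ).ConnectedComponent // Odd c.supp.ncard}

section CriticalBarrier

open Finset
open scoped Classical

variable {V α : Type*}

/-- The complement `H` of a `3`-`γ`-vertex-critical `K_{1,6}`-free graph, together with a cut set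
`S`, a labelling `f` of the components left by `S`, and a choice for every vertex `v` of a pair
`D v` whose only common neighbor in `H` is `v`. -/
structure IsCriticalBarrier (H : SimpleGraph V) (S : Finset V) (f : V → α)
    (D : V → Finset V) : Prop where
  common : ∀ p q, ∃ u, H.Adj p u ∧ H.Adj q u
  card_pair : ∀ v, (D v).card = 2
  forall_pair_adj_iff : ∀ v u, (∀ p ∈ D v, H.Adj p u) ↔ u = v
  star : ∀ c (T : Finset V), (∀ t ∈ T, c ≠ t ∧ ¬ H.Adj c t) →
    (∀ t ∈ T, ∀ t' ∈ T, t ≠ t' → H.Adj t t') → T.card ≤ 5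
  adj_of_ne : ∀ u, u ∉ S → ∀ v, v ∉ S → f u ≠ f v → H.Adj u v

/-- `I` meets no component outside `S` more than once. -/
def IsPartialTransversal (S : Finset V) (f : V → α) (I : Finset V) : Prop :=
  (∀ x ∈ I, x ∉ S) ∧ ∀ x ∈ I, ∀ y ∈ I, f x = f y → x = y

lemma IsPartialTransversal.mono {S : Finset V} {f : V → α} {I J : Finset V}
    (h : IsPartialTransversal S f I) (hJ : J ⊆ I) : IsPartialTransversal S f J :=
  ⟨fun x hx => h.1 x (hJ hx), fun x hx y hy => h.2 x (hJ hx) y (hJ hy)⟩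

lemma IsPartialTransversal.card_filter_label_le_one {S : Finset V} {f : V → α} {I : Finset V}
    (h : IsPartialTransversal S f I) (a : α) : #{x ∈ I | f x = a} ≤ 1 := by
  rw [card_le_one]
  intro x hx y hy
  rw [mem_filter] at hx hy
  exact h.2 x hx.1 y hy.1 (hx.2.trans hy.2.symm)

lemma exists_partialTransversal_image_eq {S : Finset V} {f : V → α} {L : Finset α}
    (hL : ∀ a ∈ L, ∃ x ∉ S, f x = a) {z : V} (hz : z ∉ S) :
    ∃ I, IsPartialTransversal S f I ∧ z ∈ I ∧ I.image f = insert (f z) L := by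
  have h : ∀ a ∈ insert (f z) L, ∃ x, x ∉ S ∧ f x = a ∧ (a = f z → x = z) := by
    intro a ha
    by_cases haz : a = f z
    · exact ⟨z, hz, haz.symm, fun _ => rfl⟩
    · obtain ⟨x, hx, hxa⟩ := hL a ((mem_insert.1 ha).resolve_left haz)
      exact ⟨x, hx, hxa, fun h => absurd h haz⟩
  have : Nonempty V := ⟨z⟩
  choose! r hrS hrf hrz using h
  refine ⟨(insert (f z) L).image r, ⟨?_, ?_⟩, ?_, ?_⟩
  · simp only [mem_image]
    rintro _ ⟨a, ha, rfl⟩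
    exact hrS a ha
  · simp only [mem_image]
    rintro _ ⟨a, ha, rfl⟩ _ ⟨b, hb, rfl⟩ h
    rw [hrf a ha, hrf b hb] at h
    rw [h]
  · exact mem_image.2 ⟨f z, mem_insert_self _ _, hrz _ (mem_insert_self _ _) rfl⟩
  · rw [image_image]
    ext a
    rw [mem_image]
    constructor
    · rintro ⟨b, hb, rfl⟩
      rwa [Function.comp_apply, hrf b hb]
    · intro ha
      exact ⟨a, ha, hrf a ha⟩

lemma exists_partialTransversal_card_eq {S : Finset V} {f : V → α} {L : Finset α}
    (hL : ∀ a ∈ L, ∃ x ∉ S, f x = a) {z : V} (hz : z ∉ S) {m : ℕ} (hm : 1 ≤ m)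
    (hmL : m ≤ L.card) :
    ∃ I, IsPartialTransversal S f I ∧ z ∈ I ∧ I.card = m := by
  obtain ⟨I, hI, hzI, him⟩ := exists_partialTransversal_image_eq hL hz
  have hc : L.card ≤ I.card := by
    calc L.card ≤ (insert (f z) L).card := card_le_card (subset_insert _ _)
      _ = (I.image f).card := by rw [him]
      _ ≤ I.card := card_image_le
  obtain ⟨J, hJ1, hJ2, hJ⟩ := exists_subsuperset_card_eq (s := {z}) (t := I) (n := m)
    (by simpa using hzI) (by simpa using hm) (hmL.trans hc)
  exact ⟨J, hI.mono hJ2, hJ1 (mem_singleton_self z), hJ⟩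

/-- A finite set with a fixed-point-free involution has even cardinality. -/
lemma even_card_of_involution {N : Finset V} (g : V → V) (hN : ∀ x ∈ N, g x ∈ N)
    (hg : ∀ x ∈ N, g (g x) = x) (hne : ∀ x ∈ N, g x ≠ x) : Even N.card := by
  have h : ∑ _x ∈ N, (1 : ZMod 2) = 0 :=
    sum_involution (fun x _ => g x) (fun _ _ => by decide) (fun x hx _ => hne x hx)
      (fun x hx => hN x hx) (fun x hx => hg x hx)
  rw [sum_const, nsmul_eq_mul, mul_one] at h
  exact (ZMod.natCast_eq_zero_iff_even).1 h

namespace IsCriticalBarrier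

variable {H : SimpleGraph V} {S : Finset V} {f : V → α} {D : V → Finset V}

lemma adj_of_mem (h : IsCriticalBarrier H S f D) {v p : V} (hp : p ∈ D v) : H.Adj p v :=
  (h.forall_pair_adj_iff v v).2 rfl p hp

lemma eq_of_forall_adj (h : IsCriticalBarrier H S f D) {v u : V} (hu : ∀ p ∈ D v, H.Adj p u) :
    u = v :=
  (h.forall_pair_adj_iff v u).1 hu

lemma pair_injective (h : IsCriticalBarrier H S f D) : Function.Injective D := by
  intro v w hvw
  apply h.eq_of_forall_adj
  rw [← hvw]
  exact fun p hp => h.adj_of_mem hp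

lemma notMem_pair (h : IsCriticalBarrier H S f D) (v : V) : v ∉ D v :=
  fun hv => H.irrefl (h.adj_of_mem hv)

lemma adj_of_mem_transversal (h : IsCriticalBarrier H S f D) {I : Finset V}
    (hI : IsPartialTransversal S f I) {x y : V} (hx : x ∈ I) (hy : y ∈ I) (hxy : x ≠ y) :
    H.Adj x y :=
  h.adj_of_ne x (hI.1 x hx) y (hI.1 y hy) fun he => hxy (hI.2 x hx y hy he)

/-- By `K_{1,6}`-freeness, no vertex of `S` sees more than five components. -/
lemma card_le_card_filter_add_five (h : IsCriticalBarrier H S f D) {I : Finset V}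
    (hI : IsPartialTransversal S f I) {s : V} (hs : s ∈ S) :
    I.card ≤ #{x ∈ I | H.Adj s x} + 5 := by
  have h5 := h.star s {x ∈ I | ¬ H.Adj s x}
    (fun t ht => ⟨fun hst => hI.1 t (mem_filter.1 ht).1 (hst ▸ hs), (mem_filter.1 ht).2⟩)
    (fun t ht t' ht' hne =>
      h.adj_of_mem_transversal hI (mem_filter.1 ht).1 (mem_filter.1 ht').1 hne)
  have := card_filter_add_card_filter_not (s := I) (fun x => H.Adj s x)
  omega

/-- A pair avoiding `S` dominates at most two components. -/
lemma card_le_three_of_disjoint (h : IsCriticalBarrier H S f D) {I : Finset V}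
    (hI : IsPartialTransversal S f I) {v : V} (hv : ∀ p ∈ D v, p ∉ S) :
    I.card ≤ 2 + #{x ∈ I | x = v} := by
  obtain ⟨p, q, -, hpq⟩ := card_eq_two.1 (h.card_pair v)
  have hsub : I ⊆ ({x ∈ I | f x = f p} ∪ {x ∈ I | f x = f q}) ∪ {x ∈ I | x = v} := by
    intro x hx
    simp only [mem_union, mem_filter, hx, true_and]
    by_contra! hcon
    apply hcon.2
    apply h.eq_of_forall_adj
    have hxS := hI.1 x hx
    intro r hr
    apply h.adj_of_ne r (hv r hr) x hxS
    rw [hpq, mem_insert, mem_singleton] at hr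
    rcases hr with rfl | rfl
    · exact hcon.1.1.symm
    · exact hcon.1.2.symm
  have h1 := hI.card_filter_label_le_one (f p)
  have h2 := hI.card_filter_label_le_one (f q)
  have h3 := card_le_card hsub
  have h4 := card_union_le ({x ∈ I | f x = f p} ∪ {x ∈ I | f x = f q}) {x ∈ I | x = v}
  have h5 := card_union_le {x ∈ I | f x = f p} {x ∈ I | f x = f q}
  omega

lemma exists_mem_pair_mem (h : IsCriticalBarrier H S f D) {I : Finset V}
    (hI : IsPartialTransversal S f I) (hc : 4 ≤ I.card) (v : V) : ∃ p ∈ D v, p ∈ S := by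
  by_contra! hcon
  have h1 := h.card_le_three_of_disjoint hI hcon
  have h2 : #{x ∈ I | x = v} ≤ 1 := by
    rw [card_le_one]
    intro a ha b hb
    rw [(mem_filter.1 ha).2, (mem_filter.1 hb).2]
  omega

lemma pair_eq_of_not_subset (h : IsCriticalBarrier H S f D) {I : Finset V}
    (hI : IsPartialTransversal S f I) (hc : 4 ≤ I.card) {v : V} (hv : ¬ D v ⊆ S) :
    ∃ s ∈ S, ∃ z ∉ S, D v = {s, z} := by
  obtain ⟨s, hs, hsS⟩ := h.exists_mem_pair_mem hI hc v
  obtain ⟨z, hz, hzS⟩ := not_subset.1 hv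
  refine ⟨s, hsS, z, hzS, (eq_of_subset_of_card_le ?_ ?_).symm⟩
  · intro x hx
    rw [mem_insert, mem_singleton] at hx
    rcases hx with rfl | rfl <;> assumption
  · rw [h.card_pair, Finset.card_pair]
    rintro rfl
    exact hzS hsS

lemma not_adj_of_label_ne (h : IsCriticalBarrier H S f D) {v s z : V}
    (hz : z ∉ S) (hD : D v = {s, z}) {x : V} (hx : x ∉ S) (hxz : f x ≠ f z) (hxv : x ≠ v) :
    ¬ H.Adj s x := by
  intro hsx
  apply hxv
  apply h.eq_of_forall_adj
  intro p hp
  rw [hD, mem_insert, mem_singleton] at hp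
  rcases hp with rfl | rfl
  · exact hsx
  · exact h.adj_of_ne _ hz _ hx hxz.symm

/-- If `D v = {s, z}` with `z ∉ S`, then `s` dominates all but at most two components. -/
lemma card_filter_adj_le (h : IsCriticalBarrier H S f D) {I : Finset V}
    (hI : IsPartialTransversal S f I) {v s z : V} (hz : z ∉ S) (hD : D v = {s, z}) :
    #{x ∈ I | H.Adj s x} ≤ 1 + #{x ∈ I | x = v} := by
  have hsub : {x ∈ I | H.Adj s x} ⊆ {x ∈ I | f x = f z} ∪ {x ∈ I | x = v} := by
    intro x hx
    rw [mem_filter] at hx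
    simp only [mem_union, mem_filter, hx.1, true_and]
    by_contra! hcon
    exact h.not_adj_of_label_ne hz hD (hI.1 x hx.1) hcon.1 hcon.2 hx.2
  have h1 := hI.card_filter_label_le_one (f z)
  have h3 := card_le_card hsub
  have h4 := card_union_le {x ∈ I | f x = f z} {x ∈ I | x = v}
  omega

lemma card_filter_adj_le_two (h : IsCriticalBarrier H S f D) {I : Finset V}
    (hI : IsPartialTransversal S f I) {v s z : V} (hz : z ∉ S) (hD : D v = {s, z}) :
    #{x ∈ I | H.Adj s x} ≤ 2 := by
  have h1 := h.card_filter_adj_le hI hz hD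
  have h2 : #{x ∈ I | x = v} ≤ 1 := by
    rw [card_le_one]
    intro a ha b hb
    rw [(mem_filter.1 ha).2, (mem_filter.1 hb).2]
  omega

/-- If at least eight components are left, every pair lies inside `S`. -/
lemma pair_subset_of_eight_le (h : IsCriticalBarrier H S f D) {I : Finset V}
    (hI : IsPartialTransversal S f I) (hc : 8 ≤ I.card) (v : V) : D v ⊆ S := by
  by_contra hv
  obtain ⟨s, hs, z, hz, hD⟩ := h.pair_eq_of_not_subset hI (by omega) hv
  have h1 := h.card_filter_adj_le_two hI hz hD
  have h2 := h.card_le_card_filter_add_five hI hs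
  omega

/-- The vertices whose pairs lie in `T` are at most as many as the pairs in `T`. -/
lemma card_le_choose_of_pair_subset (h : IsCriticalBarrier H S f D) {A T : Finset V}
    (hA : ∀ v ∈ A, D v ⊆ T) : A.card ≤ T.card.choose 2 := by
  rw [← card_powersetCard, ← card_image_of_injective A h.pair_injective]
  apply card_le_card
  intro P hP
  obtain ⟨v, hv, rfl⟩ := mem_image.1 hP
  exact mem_powersetCard.2 ⟨hA v hv, h.card_pair v⟩

/-! ### Small cut sets -/

lemma exists_dominator_off_label (h : IsCriticalBarrier H ∅ f D) {v v' w : V}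
    (hv' : v ≠ v' ∧ ¬ H.Adj v v') (hw : f w ≠ f v) :
    ∃ y, f y ≠ f v ∧ ∀ u, f u ≠ f v → ¬ H.Adj y u := by
  have hadj : ∀ {a b : V}, f a ≠ f b → H.Adj a b := fun {a b} hab =>
    h.adj_of_ne a (notMem_empty a) b (notMem_empty b) hab
  have hfv : f v' = f v := by
    by_contra hne
    exact hv'.2 (hadj (Ne.symm hne))
  have h1 : ∃ x ∈ D v, ¬ H.Adj x v' := by
    by_contra! hcon
    exact hv'.1 (h.eq_of_forall_adj hcon).symm
  obtain ⟨x, hx, hxv'⟩ := h1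
  have hfx : f x = f v := by
    by_contra hne
    exact hxv' (hadj (by rwa [hfv]))
  obtain ⟨y, hxy, hDxy⟩ : ∃ y, x ≠ y ∧ D v = {x, y} := by
    obtain ⟨a, b, hab, hD⟩ := card_eq_two.1 (h.card_pair v)
    rw [hD, mem_insert, mem_singleton] at hx
    rcases hx with rfl | rfl
    · exact ⟨b, hab, hD⟩
    · exact ⟨a, hab.symm, by rw [hD, pair_comm]⟩
  have hy : ∀ u, f u ≠ f v → ¬ H.Adj y u := by
    intro u hu hyu
    apply hu
    rw [h.eq_of_forall_adj (v := v) (u := u)]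
    intro p hp
    rw [hDxy, mem_insert, mem_singleton] at hp
    rcases hp with rfl | rfl
    · exact hadj (by rw [hfx]; exact hu.symm)
    · exact hyu
  refine ⟨y, fun hfy => hy w hw (hadj (by rw [hfy]; exact hw.symm)), hy⟩

/-- An isolated vertex forces odd order. -/
lemma even_card_compl_of_isolated [Fintype V] (h : IsCriticalBarrier H S f D) {v : V}
    (hv : ∀ u, u ≠ v → H.Adj v u) : Even (univ.erase v).card := by
  have key : ∀ w, w ≠ v → ∃ z, z ≠ v ∧ D w = {v, z} := by
    intro w hw
    have hvD : v ∈ D w := by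
      by_contra hvD
      apply hw.symm
      apply h.eq_of_forall_adj
      intro p hp
      exact (hv p fun hpv => hvD (hpv ▸ hp)).symm
    obtain ⟨a, b, hab, hD⟩ := card_eq_two.1 (h.card_pair w)
    rw [hD, mem_insert, mem_singleton] at hvD
    rcases hvD with rfl | rfl
    · exact ⟨b, hab.symm, hD⟩
    · exact ⟨a, hab, by rw [hD, pair_comm]⟩
  choose! g hgv hgD using key
  have hgm : ∀ w, w ≠ v → g w ∈ D w := fun w hw => by rw [hgD w hw]; simp
  refine even_card_of_involution g ?_ ?_ ?_
  · intro x hx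
    exact mem_erase.2 ⟨hgv x (ne_of_mem_erase hx), mem_univ _⟩
  · intro x hx
    have hx' := ne_of_mem_erase hx
    have hgx := hgv x hx'
    apply h.eq_of_forall_adj
    intro p hp
    rw [hgD x hx', mem_insert, mem_singleton] at hp
    rcases hp with rfl | rfl
    · exact hv _ (hgv _ hgx)
    · exact (h.adj_of_mem (hgm _ hgx)).symm
  · intro x hx he
    have hx' := ne_of_mem_erase hx
    exact h.notMem_pair x (by simpa [he] using hgm x hx')

lemma not_card_eq_zero [Fintype V] (h : IsCriticalBarrier H S f D) (hS : S.card = 0)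
    (heven : Even (Fintype.card V)) {v w : V} (hvw : f v ≠ f w) : False := by
  obtain rfl := card_eq_zero.1 hS
  have hiso : ∀ v : V, ∃ v', v ≠ v' ∧ ¬ H.Adj v v' := by
    by_contra! hcon
    obtain ⟨v, hv⟩ := hcon
    have h1 := h.even_card_compl_of_isolated (v := v) fun u hu => hv u hu.symm
    rw [card_erase_of_mem (mem_univ v), card_univ] at h1
    have h2 : 0 < Fintype.card V := Fintype.card_pos_iff.2 ⟨v⟩
    rcases heven with ⟨a, ha⟩
    rcases h1 with ⟨b, hb⟩
    omega
  obtain ⟨v', hv'⟩ := hiso v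
  obtain ⟨w', hw'⟩ := hiso w
  obtain ⟨y, -, hy⟩ := h.exists_dominator_off_label hv' hvw.symm
  obtain ⟨x, -, hx⟩ := h.exists_dominator_off_label hw' hvw
  obtain ⟨u, hyu, hxu⟩ := h.common y x
  have h1 : f u = f v := by
    by_contra hne
    exact hy u hne hyu
  have h2 : f u = f w := by
    by_contra hne
    exact hx u hne hxu
  exact hvw (h1.symm.trans h2)

lemma not_card_eq_one (h : IsCriticalBarrier H S f D) (hS : S.card = 1) {I : Finset V}
    (hI : IsPartialTransversal S f I) (hc : 3 ≤ I.card) : False := by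
  obtain ⟨u, rfl⟩ := card_eq_one.1 hS
  have h1 := h.card_le_three_of_disjoint hI (v := u) fun p hp hpu =>
    h.notMem_pair u (mem_singleton.1 hpu ▸ hp)
  have h2 : #{x ∈ I | x = u} = 0 := by
    rw [card_eq_zero, filter_eq_empty_iff]
    rintro x hx rfl
    exact hI.1 x hx (mem_singleton_self x)
  omega

/-- The member of `D a` inside `S = {a, b}` dominates all but one component. -/
lemma card_filter_adj_le_one_of_pair (h : IsCriticalBarrier H S f D) {a b : V}
    (hS : S = {a, b}) {I : Finset V} (hI : IsPartialTransversal S f I) (hc : 4 ≤ I.card) :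
    #{x ∈ I | H.Adj b x} ≤ 1 := by
  have ha : a ∈ S := by rw [hS]; simp
  have hsub : ¬ D a ⊆ S := by
    intro hsub
    have h1 : D a ⊆ {b} := by
      intro p hp
      have hpS := hsub hp
      rw [hS, mem_insert, mem_singleton] at hpS
      rcases hpS with rfl | rfl
      · exact absurd hp (h.notMem_pair p)
      · simp
    have h2 := card_le_card h1
    rw [h.card_pair, card_singleton] at h2
    omega
  obtain ⟨s, hs, z, hz, hD⟩ := h.pair_eq_of_not_subset hI hc hsub
  have hsb : s = b := by
    have hs' := hs
    rw [hS, mem_insert, mem_singleton] at hs'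
    rcases hs' with rfl | rfl
    · exact absurd (by rw [hD]; simp) (h.notMem_pair s)
    · rfl
  have h1 := h.card_filter_adj_le hI hz hD
  have h2 : #{x ∈ I | x = a} = 0 := by
    rw [card_eq_zero, filter_eq_empty_iff]
    rintro x hx rfl
    exact hI.1 x hx ha
  rw [← hsb]
  omega

lemma not_card_eq_two (h : IsCriticalBarrier H S f D) (hS : S.card = 2) {I : Finset V}
    (hI : IsPartialTransversal S f I) (hc : 4 ≤ I.card) : False := by
  obtain ⟨a, b, -, hab⟩ := card_eq_two.1 hS
  have h1 := h.card_filter_adj_le_one_of_pair hab hI hc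
  have h2 := h.card_filter_adj_le_one_of_pair (hab.trans (pair_comm a b)) hI hc
  have h3 : I ⊆ {x ∈ I | H.Adj a x} ∪ {x ∈ I | H.Adj b x} := by
    intro x hx
    obtain ⟨p, hp, hpS⟩ := h.exists_mem_pair_mem hI hc x
    have hpx := h.adj_of_mem hp
    rw [hab, mem_insert, mem_singleton] at hpS
    rw [mem_union, mem_filter, mem_filter]
    rcases hpS with rfl | rfl
    · exact .inl ⟨hx, hpx⟩
    · exact .inr ⟨hx, hpx⟩
  have h4 := card_le_card h3
  have h5 := card_union_le {x ∈ I | H.Adj a x} {x ∈ I | H.Adj b x}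
  omega

/-- If every member of `I'` has its pair inside `U` or is missed by some vertex of `P`, then the
vertices missed by `P` and the pairs inside `U \ P` together bound `I'.card`. -/
lemma card_le_of_served (h : IsCriticalBarrier H S f D) {I' U P : Finset V}
    (hserved : ∀ x ∈ I', D x ⊆ U ∨ ∃ s ∈ P, H.Adj s x) :
    I'.card ≤ ∑ s ∈ P, #{x ∈ I' | H.Adj s x} + ((U \ P).card).choose 2 := by
  have hsub : I' ⊆ (P.biUnion fun s => {x ∈ I' | H.Adj s x}) ∪ {x ∈ I' | D x ⊆ U \ P} := by
    intro x hx
    rw [mem_union]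
    by_cases hP : ∃ s ∈ P, H.Adj s x
    · obtain ⟨s, hs, hsx⟩ := hP
      exact .inl (mem_biUnion.2 ⟨s, hs, mem_filter.2 ⟨hx, hsx⟩⟩)
    · refine .inr (mem_filter.2 ⟨hx, fun p hp => mem_sdiff.2 ⟨?_, fun hpP => ?_⟩⟩)
      · exact (hserved x hx).resolve_right hP hp
      · exact hP ⟨p, hpP, h.adj_of_mem hp⟩
  have h1 := card_le_card hsub
  have h2 := card_union_le (P.biUnion fun s => {x ∈ I' | H.Adj s x}) {x ∈ I' | D x ⊆ U \ P}
  have h3 : (P.biUnion fun s => {x ∈ I' | H.Adj s x}).card ≤ ∑ s ∈ P, #{x ∈ I' | H.Adj s x} :=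
    card_biUnion_le
  have h4 := h.card_le_choose_of_pair_subset (A := {x ∈ I' | D x ⊆ U \ P}) (T := U \ P)
    fun v hv => (mem_filter.1 hv).2
  omega

/-- If all pairs of vertices of a three-element `S` lie in `S`, the order is odd. -/
lemma even_card_compl_of_card_eq_three [Fintype V] (h : IsCriticalBarrier H S f D)
    (hS : S.card = 3) (hI : ∀ z ∉ S, ∃ I, IsPartialTransversal S f I ∧ z ∈ I ∧ 4 ≤ I.card)
    (hB : ∀ v ∈ S, D v ⊆ S) : Even Sᶜ.card := by
  have hD : ∀ s ∈ S, D s = S.erase s := by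
    intro s hs
    apply eq_of_subset_of_card_le
    · intro p hp
      exact mem_erase.2 ⟨fun hps => h.notMem_pair s (hps ▸ hp), hB s hs hp⟩
    · rw [h.card_pair, card_erase_of_mem hs, hS]
  have hadj : ∀ s ∈ S, ∀ t ∈ S, s ≠ t → H.Adj s t := fun s hs t ht hst =>
    h.adj_of_mem (by rw [hD t ht]; exact mem_erase.2 ⟨hst, hs⟩)
  have huniq : ∀ x ∉ S, ∀ s ∈ S, ∀ t ∈ S, H.Adj s x → H.Adj t x → s = t := by
    intro x hx s hs t ht hsx htx
    by_contra hst
    have hsub : ({s, t} : Finset V) ⊆ S := by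
      intro p hp
      rw [mem_insert, mem_singleton] at hp
      rcases hp with rfl | rfl <;> assumption
    obtain ⟨u, hu, hust⟩ := exists_mem_notMem_of_card_lt_card
      (s := {s, t}) (t := S) (by rw [Finset.card_pair hst]; omega)
    have hDu : D u = {s, t} := by
      symm
      apply eq_of_subset_of_card_le
      · rw [hD u hu]
        intro p hp
        exact mem_erase.2 ⟨fun hpu => hust (hpu ▸ hp), hsub hp⟩
      · rw [h.card_pair, Finset.card_pair hst]
    apply hx
    rw [h.eq_of_forall_adj (v := u) (u := x)]
    · exact hu
    · intro p hp
      rw [hDu, mem_insert, mem_singleton] at hp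
      rcases hp with rfl | rfl <;> assumption
  have key : ∀ x, x ∉ S → ∃ s z, s ∈ S ∧ z ∉ S ∧ D x = {s, z} ∧ H.Adj s z := by
    intro x hx
    have hsub : ¬ D x ⊆ S := by
      intro hsub
      obtain ⟨a, b, hab, hDx⟩ := card_eq_two.1 (h.card_pair x)
      have ha : a ∈ D x := by rw [hDx]; simp
      have hb : b ∈ D x := by rw [hDx]; simp
      exact hab (huniq x hx a (hsub ha) b (hsub hb) (h.adj_of_mem ha) (h.adj_of_mem hb))
    obtain ⟨I, hI1, -, hI2⟩ := hI x hx
    obtain ⟨s, hs, z, hz, hDx⟩ := h.pair_eq_of_not_subset hI1 hI2 hsub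
    refine ⟨s, z, hs, hz, hDx, ?_⟩
    obtain ⟨p, hp, hpS⟩ := h.exists_mem_pair_mem hI1 hI2 z
    by_cases hps : p = s
    · exact hps ▸ h.adj_of_mem hp
    · refine absurd (h.eq_of_forall_adj (v := x) (u := p) ?_) fun hpx => hx (hpx ▸ hpS)
      intro r hr
      rw [hDx, mem_insert, mem_singleton] at hr
      rcases hr with rfl | rfl
      · exact hadj _ hs _ hpS (Ne.symm hps)
      · exact (h.adj_of_mem hp).symm
  choose! σ g hσ hg hDg hadjg using key
  have hgm : ∀ x, x ∉ S → g x ∈ D x := fun x hx => by rw [hDg x hx]; simp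
  have hσm : ∀ x, x ∉ S → σ x ∈ D x := fun x hx => by rw [hDg x hx]; simp
  refine even_card_of_involution g ?_ ?_ ?_
  · intro x hx
    exact mem_compl.2 (hg x (mem_compl.1 hx))
  · intro x hx
    rw [mem_compl] at hx
    have hgx := hg x hx
    have hσe : σ (g x) = σ x :=
      huniq _ hgx _ (hσ _ hgx) _ (hσ _ hx) (h.adj_of_mem (hσm _ hgx)) (hadjg x hx)
    apply h.eq_of_forall_adj
    intro p hp
    rw [hDg x hx, mem_insert, mem_singleton] at hp
    rcases hp with rfl | rfl
    · rw [← hσe]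
      exact hadjg _ hgx
    · exact (h.adj_of_mem (hgm _ hgx)).symm
  · intro x hx he
    rw [mem_compl] at hx
    exact h.notMem_pair x (by simpa [he] using hgm x hx)

lemma not_adj_of_mem_erase (h : IsCriticalBarrier H S f D) {I : Finset V}
    (hI : IsPartialTransversal S f I) {v e z : V} (hv : v ∈ S) (hz : z ∉ S) (hzI : z ∈ I)
    (hD : D v = {e, z}) {x : V} (hx : x ∈ I.erase z) : ¬ H.Adj e x := by
  obtain ⟨hxz, hxI⟩ := mem_erase.1 hx
  have hxS := hI.1 x hxI
  exact h.not_adj_of_label_ne hz hD hxS (fun hf => hxz (hI.2 x hxI z hzI hf))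
    fun hxv => hxS (hxv ▸ hv)

lemma not_card_eq_three [Fintype V] (h : IsCriticalBarrier H S f D) (hS : S.card = 3)
    (heven : Even (Fintype.card V))
    (hI : ∀ z ∉ S, ∃ I, IsPartialTransversal S f I ∧ z ∈ I ∧ I.card = 5) : False := by
  by_cases hB : ∀ v ∈ S, D v ⊆ S
  · have h1 := h.even_card_compl_of_card_eq_three hS
      (fun z hz => (hI z hz).imp fun I hI => ⟨hI.1, hI.2.1, by omega⟩) hB
    rw [card_compl, hS] at h1
    have h2 : S.card ≤ Fintype.card V := card_le_univ S
    rcases heven with ⟨a, ha⟩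
    rcases h1 with ⟨b, hb⟩
    omega
  push Not at hB
  obtain ⟨v, hv, hvS⟩ := hB
  obtain ⟨y, -, hy⟩ := not_subset.1 hvS
  obtain ⟨J, hJ, -, hJc⟩ := hI y hy
  obtain ⟨e, he, z, hz, hD⟩ := h.pair_eq_of_not_subset hJ (by omega) hvS
  obtain ⟨I, hI, hzI, hIc⟩ := hI z hz
  have hex := fun x hx => h.not_adj_of_mem_erase hI hv hz hzI hD (x := x) hx
  have heD : e ∈ D v := by rw [hD]; simp
  have hve : v ≠ e := (h.adj_of_mem heD).ne'
  have hvz : H.Adj v z := (h.adj_of_mem (by rw [hD]; simp)).symm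
  let P : Finset V := {s ∈ S.erase e | #{x ∈ I | H.Adj s x} ≤ 2}
  have hPU : P ⊆ S.erase e := filter_subset _ _
  have hserved : ∀ x ∈ I.erase z, D x ⊆ S.erase e ∨ ∃ s ∈ P, H.Adj s x := by
    intro x hx
    have heDx : e ∉ D x := fun heDx => hex x hx (h.adj_of_mem heDx)
    by_cases hxS : D x ⊆ S
    · exact .inl fun p hp => mem_erase.2 ⟨fun hpe => heDx (hpe ▸ hp), hxS hp⟩
    · obtain ⟨s, hs, w, hw, hDx⟩ := h.pair_eq_of_not_subset hI (by omega) hxS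
      have hsD : s ∈ D x := by rw [hDx]; simp
      refine .inr ⟨s, mem_filter.2 ⟨mem_erase.2 ⟨fun hse => heDx (hse ▸ hsD), hs⟩, ?_⟩,
        h.adj_of_mem hsD⟩
      exact h.card_filter_adj_le_two hI hw hDx
  have h1 := h.card_le_of_served hserved
  rw [card_erase_of_mem hzI, hIc, card_sdiff_of_subset hPU, card_erase_of_mem he, hS] at h1
  have hmono : ∀ s ∈ P, #{x ∈ I.erase z | H.Adj s x} ≤ 2 := fun s hs =>
    (card_le_card (filter_subset_filter _ (erase_subset _ _))).trans (mem_filter.1 hs).2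
  have hP2 : P.card ≤ 2 := (card_le_card hPU).trans (by rw [card_erase_of_mem he, hS])
  by_cases hvP : v ∈ P
  · have h2 : #{x ∈ I.erase z | H.Adj v x} ≤ 1 := by
      have hlt : #{x ∈ I.erase z | H.Adj v x} < #{x ∈ I | H.Adj v x} :=
        card_lt_card ⟨filter_subset_filter _ (erase_subset _ _), fun hsub => ne_of_mem_erase
          (mem_filter.1 (hsub (mem_filter.2 ⟨hzI, hvz⟩))).1 rfl⟩
      have h3 : #{x ∈ I | H.Adj v x} ≤ 2 := (mem_filter.1 hvP).2
      omega
    rw [← add_sum_erase P _ hvP] at h1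
    have h3 := sum_le_card_nsmul (P.erase v) (fun s => #{x ∈ I.erase z | H.Adj s x}) 2
      fun s hs => hmono s (mem_of_mem_erase hs)
    rw [card_erase_of_mem hvP, smul_eq_mul] at h3
    have h4 : 0 < P.card := card_pos.2 ⟨v, hvP⟩
    have h5 : ∀ m ≤ 2, 1 ≤ m → 1 + (m - 1) * 2 + (3 - 1 - m).choose 2 ≤ 3 := by decide
    have h6 := h5 _ hP2 h4
    omega
  · have h3 := sum_le_card_nsmul P (fun s => #{x ∈ I.erase z | H.Adj s x}) 2 hmono
    rw [smul_eq_mul] at h3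
    have h4 : P.card ≤ 1 := by
      have : P ⊆ (S.erase e).erase v := fun s hs =>
        mem_erase.2 ⟨fun hsv => hvP (hsv ▸ hs), hPU hs⟩
      have := card_le_card this
      rwa [card_erase_of_mem (mem_erase.2 ⟨hve, hv⟩), card_erase_of_mem he, hS] at this
    have h5 : ∀ m ≤ 1, m * 2 + (3 - 1 - m).choose 2 ≤ 3 := by decide
    have h6 := h5 _ h4
    omega

/-- In a four-element `S`, some vertex of `S` has a pair leaving `S`. -/
lemma exists_pair_not_subset_of_card_eq_four (h : IsCriticalBarrier H S f D) (hS : S.card = 4) :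
    ∃ v ∈ S, ¬ D v ⊆ S := by
  by_contra! hB
  obtain ⟨v, hv⟩ : S.Nonempty := card_pos.1 (by omega)
  obtain ⟨w, hw, hwD⟩ := exists_mem_notMem_of_card_lt_card (s := insert v (D v)) (t := S)
    ((card_insert_le _ _).trans_lt (by rw [h.card_pair]; omega))
  rw [mem_insert, not_or] at hwD
  obtain ⟨s, hs, hsw⟩ : ∃ s ∈ D v, ¬ H.Adj s w := by
    by_contra! hcon
    exact hwD.1 (h.eq_of_forall_adj hcon)
  have hsw' : s ≠ w := fun hsw => hwD.2 (hsw ▸ hs)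
  have hsS := hB v hv hs
  have hpair : ∀ x ∈ ({s, w} : Finset V), D x = S \ {s, w} := by
    intro x hx
    have hxS : x ∈ S := by
      rw [mem_insert, mem_singleton] at hx
      rcases hx with rfl | rfl <;> assumption
    have hsub : ({s, w} : Finset V) ⊆ S := by
      intro p hp
      rw [mem_insert, mem_singleton] at hp
      rcases hp with rfl | rfl <;> assumption
    apply eq_of_subset_of_card_le
    · intro p hp
      refine mem_sdiff.2 ⟨hB x hxS hp, fun hpsw => ?_⟩
      have hpx := h.adj_of_mem hp
      rw [mem_insert, mem_singleton] at hx hpsw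
      rcases hx with rfl | rfl <;> rcases hpsw with rfl | rfl
      · exact H.irrefl hpx
      · exact hsw hpx.symm
      · exact hsw hpx
      · exact H.irrefl hpx
    · rw [h.card_pair, card_sdiff_of_subset hsub, Finset.card_pair hsw', hS]
  apply hsw'
  apply h.pair_injective
  rw [hpair s (by simp), hpair w (by simp)]

lemma not_card_eq_four (h : IsCriticalBarrier H S f D) (hS : S.card = 4)
    (hI : ∀ z ∉ S, ∃ I, IsPartialTransversal S f I ∧ z ∈ I ∧ I.card = 6) : False := by
  obtain ⟨v, hv, hvS⟩ := h.exists_pair_not_subset_of_card_eq_four hS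
  obtain ⟨y, -, hy⟩ := not_subset.1 hvS
  obtain ⟨J, hJ, -, hJc⟩ := hI y hy
  obtain ⟨e, he, z, hz, hD⟩ := h.pair_eq_of_not_subset hJ (by omega) hvS
  obtain ⟨I, hI, hzI, hIc⟩ := hI z hz
  have hex := fun x hx => h.not_adj_of_mem_erase hI hv hz hzI hD (x := x) hx
  have heD : e ∈ D v := by rw [hD]; simp
  have hve : v ≠ e := (h.adj_of_mem heD).ne'
  have hvz : H.Adj v z := (h.adj_of_mem (by rw [hD]; simp)).symm
  -- `e` sees no vertex of the component of `z`, since it sees five other components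
  have hez : ∀ u ∉ S, f u = f z → H.Adj e u := by
    intro u hu hfu
    by_contra heu
    have huI : ∀ x ∈ I.erase z, x ∉ S ∧ f u ≠ f x := fun x hx =>
      ⟨hI.1 x (mem_of_mem_erase hx), fun hux => ne_of_mem_erase hx
        (hI.2 x (mem_of_mem_erase hx) z hzI (hux.symm.trans hfu))⟩
    have h5 := h.star e (insert u (I.erase z)) ?_ ?_
    · rw [card_insert_of_notMem fun hmem => (huI u hmem).2 rfl, card_erase_of_mem hzI] at h5
      omega
    · intro t ht
      rcases mem_insert.1 ht with rfl | ht
      · exact ⟨fun het => hu (het ▸ he), heu⟩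
      · exact ⟨fun het => (huI t ht).1 (het ▸ he), hex t ht⟩
    · intro t ht t' ht' htt'
      rcases mem_insert.1 ht with htu | ht <;> rcases mem_insert.1 ht' with htu' | ht'
      · exact absurd (htu.trans htu'.symm) htt'
      · exact htu ▸ h.adj_of_ne _ hu _ (huI t' ht').1 (huI t' ht').2
      · exact htu' ▸ (h.adj_of_ne _ hu _ (huI t ht).1 (huI t ht).2).symm
      · exact h.adj_of_mem_transversal hI (mem_of_mem_erase ht) (mem_of_mem_erase ht') htt'
  let P : Finset V := {s ∈ (S.erase e).erase v | #{x ∈ I | H.Adj s x} ≤ 2}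
  have hPU : P ⊆ (S.erase e).erase v := filter_subset _ _
  have hserved : ∀ x ∈ I.erase z, D x ⊆ S.erase e ∨ ∃ s ∈ P, H.Adj s x := by
    intro x hx
    have heDx : e ∉ D x := fun heDx => hex x hx (h.adj_of_mem heDx)
    by_cases hxS : D x ⊆ S
    · exact .inl fun p hp => mem_erase.2 ⟨fun hpe => heDx (hpe ▸ hp), hxS hp⟩
    · obtain ⟨s, hs, w, hw, hDx⟩ := h.pair_eq_of_not_subset hI (by omega) hxS
      have hsD : s ∈ D x := by rw [hDx]; simp
      have hsv : s ≠ v := by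
        rintro rfl
        have hfw : f w = f z := by
          by_contra hfw
          exact h.not_adj_of_label_ne hw hDx hz (Ne.symm hfw) (ne_of_mem_erase hx).symm hvz
        refine hI.1 x (mem_of_mem_erase hx) ?_
        rw [← h.eq_of_forall_adj (v := x) (u := e)]
        · exact he
        intro p hp
        rw [hDx, mem_insert, mem_singleton] at hp
        rcases hp with rfl | rfl
        · exact (h.adj_of_mem heD).symm
        · exact (hez _ hw hfw).symm
      refine .inr ⟨s, mem_filter.2 ⟨mem_erase.2 ⟨hsv, mem_erase.2
        ⟨fun hse => heDx (hse ▸ hsD), hs⟩⟩, ?_⟩, h.adj_of_mem hsD⟩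
      exact h.card_filter_adj_le_two hI hw hDx
  have h1 := h.card_le_of_served hserved
  rw [card_erase_of_mem hzI, hIc, card_sdiff_of_subset (hPU.trans (erase_subset _ _)),
    card_erase_of_mem he, hS] at h1
  have h3 := sum_le_card_nsmul P (fun s => #{x ∈ I.erase z | H.Adj s x}) 2 fun s hs =>
    (card_le_card (filter_subset_filter _ (erase_subset _ _))).trans (mem_filter.1 hs).2
  rw [smul_eq_mul] at h3
  have h4 : P.card ≤ 2 := by
    have := card_le_card hPU
    rwa [card_erase_of_mem (mem_erase.2 ⟨hve, hv⟩), card_erase_of_mem he, hS] at this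
  have h5 : ∀ m ≤ 2, m * 2 + (4 - 1 - m).choose 2 ≤ 4 := by decide
  have h6 := h5 _ h4
  omega

/-! ### Large cut sets -/

/-- The number of members of `I` missed by all of `T`, each `s` being credited only with `R s`. -/
noncomputable def missCount (I : Finset V) (R : V → Finset V) (T : Finset V) : ℕ :=
  #{x ∈ I | ∀ s ∈ T, x ∈ R s}

lemma sum_missCount_powersetCard_two (I S : Finset V) (R : V → Finset V) :
    ∑ T ∈ S.powersetCard 2, missCount I R T = ∑ x ∈ I, (#{s ∈ S | x ∈ R s}).choose 2 := by
  have h := sum_card_bipartiteAbove_eq_sum_card_bipartiteBelow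
    (s := S.powersetCard 2) (t := I) (fun T x => ∀ s ∈ T, x ∈ R s)
  refine h.trans (sum_congr rfl fun x _ => ?_)
  rw [← card_powersetCard]
  congr 1
  ext T
  simp only [bipartiteBelow, mem_filter, mem_powersetCard, subset_iff]
  grind

lemma missCount_le_of_mem {I T : Finset V} {R : V → Finset V} {s : V} (hs : s ∈ T) :
    missCount I R T ≤ (R s).card :=
  card_le_card fun _ hx => (mem_filter.1 hx).2 s hs

lemma missCount_pair_le (h : IsCriticalBarrier H S f D) {I : Finset V} {R : V → Finset V}
    (hD : ∀ v, D v ⊆ S) (hR : ∀ s ∈ S, ∀ x ∈ R s, H.Adj s x) (v : V) :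
    missCount I R (D v) ≤ #{x ∈ I | x = v} :=
  card_le_card fun x hx => by
    rw [mem_filter] at hx ⊢
    exact ⟨hx.1, h.eq_of_forall_adj fun p hp => hR p (hD v hp) x (hx.2 p hp)⟩

/-- The pairs of the vertices in `S ∪ I` together miss at most `I.card` members of `I`. -/
lemma sum_missCount_image_le (h : IsCriticalBarrier H S f D) {I : Finset V} {R : V → Finset V}
    (hI : ∀ x ∈ I, x ∉ S) (hD : ∀ v, D v ⊆ S) (hR : ∀ s ∈ S, ∀ x ∈ R s, H.Adj s x) :
    ∑ T ∈ (S ∪ I).image D, missCount I R T ≤ I.card := by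
  rw [sum_image fun v _ w _ hvw => h.pair_injective hvw,
    sum_union (disjoint_left.2 fun x hxS hxI => hI x hxI hxS)]
  have h1 : ∑ v ∈ S, missCount I R (D v) = 0 := by
    refine sum_eq_zero fun v hv => ?_
    have h2 := h.missCount_pair_le (I := I) hD hR v
    have h3 : #{x ∈ I | x = v} = 0 := by
      rw [card_eq_zero, filter_eq_empty_iff]
      rintro x hx rfl
      exact hI x hx hv
    omega
  have h2 : ∑ v ∈ I, missCount I R (D v) ≤ I.card • 1 := by
    refine sum_le_card_nsmul _ _ _ fun v _ => (h.missCount_pair_le hD hR v).trans ?_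
    rw [card_le_one]
    intro a ha b hb
    rw [(mem_filter.1 ha).2, (mem_filter.1 hb).2]
  rw [smul_eq_mul, mul_one] at h2
  omega

lemma card_le_ten (h : IsCriticalBarrier H S f D) {I : Finset V}
    (hI : IsPartialTransversal S f I) (hD : ∀ v, D v ⊆ S) (hS : S.Nonempty) : I.card ≤ 10 := by
  obtain ⟨v, hv⟩ := hS
  have hsub : I ⊆ (D v).biUnion fun p => {x ∈ I | ¬ H.Adj p x} := by
    intro x hx
    by_contra hcon
    refine hI.1 x hx ?_
    rw [h.eq_of_forall_adj (v := v) (u := x)]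
    · exact hv
    intro p hp
    by_contra hpx
    exact hcon (mem_biUnion.2 ⟨p, hp, mem_filter.2 ⟨hx, hpx⟩⟩)
  have h1 := card_biUnion_le_card_mul (D v) (fun p => {x ∈ I | ¬ H.Adj p x}) 5 fun p hp => by
    have h2 := h.card_le_card_filter_add_five hI (hD v hp)
    have h3 := card_filter_add_card_filter_not (s := I) (fun x => H.Adj p x)
    omega
  rw [h.card_pair] at h1
  exact (card_le_card hsub).trans h1

/-- Some two vertices of `S` whose pair is not chosen by `S ∪ I` miss different five-sets. -/
lemma exists_missCount_lt_five (h : IsCriticalBarrier H S f D) {I : Finset V} {R : V → Finset V}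
    (hD : ∀ v, D v ⊆ S) (hR : ∀ s ∈ S, ∀ x ∈ R s, H.Adj s x) (hRc : ∀ s ∈ S, (R s).card = 5)
    {x : V} (hx : 3 ≤ #{s ∈ S | x ∈ R s}) :
    ∃ T ∈ S.powersetCard 2 \ (S ∪ I).image D, missCount I R T < 5 := by
  by_contra! hcon
  obtain ⟨p, hp, hpD⟩ := exists_mem_notMem_of_card_lt_card (s := D x) (t := {s ∈ S | x ∈ R s})
    (by rw [h.card_pair]; omega)
  obtain ⟨hpS, hxp⟩ := mem_filter.1 hp
  have hpx := hR p hpS x hxp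
  have heq : ∀ a ∈ D x, R a = R p := by
    intro a ha
    have hap : a ≠ p := fun hap => hpD (hap ▸ ha)
    have h5 := hcon {a, p} ?_
    · have h1 : ∀ r ∈ ({a, p} : Finset V), {y ∈ I | ∀ s ∈ ({a, p} : Finset V), y ∈ R s} = R r := by
        intro r hr
        apply eq_of_subset_of_card_le
        · exact fun y hy => (mem_filter.1 hy).2 r hr
        · rw [hRc r]
          · exact h5
          · rw [mem_insert, mem_singleton] at hr
            rcases hr with rfl | rfl
            · exact hD x ha
            · exact hpS
      exact (h1 a (by simp)).symm.trans (h1 p (by simp))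
    · refine mem_sdiff.2 ⟨mem_powersetCard.2 ⟨?_, Finset.card_pair hap⟩, fun hmem => ?_⟩
      · intro r hr
        rw [mem_insert, mem_singleton] at hr
        rcases hr with rfl | rfl
        · exact hD x ha
        · exact hpS
      · obtain ⟨w, -, hw⟩ := mem_image.1 hmem
        have hxw : x = w := by
          apply h.eq_of_forall_adj
          intro r hr
          rw [hw, mem_insert, mem_singleton] at hr
          rcases hr with rfl | rfl
          · exact h.adj_of_mem ha
          · exact hpx
        apply hpD
        rw [hxw, hw]
        simp
  have hsub : R p ⊆ {x} := by
    intro y hy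
    rw [mem_singleton]
    apply h.eq_of_forall_adj
    intro a ha
    exact hR a (hD x ha) y (by rwa [heq a ha])
  have := card_le_card hsub
  rw [hRc p hpS, card_singleton] at this
  omega

lemma two_mul_le_choose_two_add_three (q : ℕ) : 2 * q ≤ q.choose 2 + 3 := by
  induction q with
  | zero => omega
  | succ q ih =>
    have hq : (q + 1).choose 2 = q.choose 1 + q.choose 2 := Nat.choose_succ_succ' q 1
    rw [hq, Nat.choose_one_right]
    rcases Nat.lt_or_ge q 2 with hlt | hge
    · interval_cases q <;> decide
    · omega

lemma three_mul_le_choose_two_add_six (q : ℕ) : 3 * q ≤ q.choose 2 + 6 := by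
  induction q with
  | zero => omega
  | succ q ih =>
    have hq : (q + 1).choose 2 = q.choose 1 + q.choose 2 := Nat.choose_succ_succ' q 1
    rw [hq, Nat.choose_one_right]
    rcases Nat.lt_or_ge q 3 with hlt | hge
    · interval_cases q <;> decide
    · omega

lemma card_lt_six (h : IsCriticalBarrier H S f D) {I : Finset V}
    (hI : IsPartialTransversal S f I) (hIc : I.card = S.card + 2) : S.card < 6 := by
  by_contra! h6
  have hD := h.pair_subset_of_eight_le hI (by omega)
  have h8 : S.card ≤ 8 := by
    have := h.card_le_ten hI hD (card_pos.1 (by omega))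
    omega
  have hRex : ∀ s ∈ S, ∃ R ⊆ {x ∈ I | H.Adj s x}, R.card = S.card - 3 := fun s hs =>
    exists_subset_card_eq (by have := h.card_le_card_filter_add_five hI hs; omega)
  choose! R hRsub hRc using hRex
  have hR : ∀ s ∈ S, ∀ x ∈ R s, H.Adj s x := fun s hs x hx => (mem_filter.1 (hRsub s hs hx)).2
  have hq : ∑ x ∈ I, #{s ∈ S | x ∈ R s} = S.card * (S.card - 3) := by
    have h1 := sum_card_bipartiteAbove_eq_sum_card_bipartiteBelow
      (s := I) (t := S) (fun x s => x ∈ R s)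
    refine h1.trans ?_
    rw [← smul_eq_mul, ← sum_const]
    refine sum_congr rfl fun s hs => ?_
    rw [← hRc s hs]
    congr 1
    ext x
    simp only [bipartiteBelow, mem_filter]
    exact ⟨fun hx => hx.2, fun hx => ⟨(mem_filter.1 (hRsub s hs hx)).1, hx⟩⟩
  have hsum := sum_missCount_powersetCard_two I S R
  have himage : (S ∪ I).image D ⊆ S.powersetCard 2 := fun T hT => by
    obtain ⟨v, -, rfl⟩ := mem_image.1 hT
    exact mem_powersetCard.2 ⟨hD v, h.card_pair v⟩
  rw [← sum_sdiff himage] at hsum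
  have h1 := h.sum_missCount_image_le hI.1 hD hR
  have hcard : (S.powersetCard 2 \ (S ∪ I).image D).card = S.card.choose 2 - (2 * S.card + 2) := by
    rw [card_sdiff_of_subset himage, card_powersetCard, card_image_of_injective _ h.pair_injective,
      card_union_of_disjoint (disjoint_left.2 fun x hxS hxI => hI.1 x hxI hxS)]
    omega
  have hle : ∀ T ∈ S.powersetCard 2 \ (S ∪ I).image D, missCount I R T ≤ S.card - 3 := by
    intro T hT
    obtain ⟨hTS, hTc⟩ := mem_powersetCard.1 (mem_sdiff.1 hT).1
    obtain ⟨s, hs⟩ : T.Nonempty := card_pos.1 (by omega)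
    rw [← hRc s (hTS hs)]
    exact missCount_le_of_mem hs
  have h2 : ∑ T ∈ S.powersetCard 2 \ (S ∪ I).image D, missCount I R T ≤
      (S.card.choose 2 - (2 * S.card + 2)) * (S.card - 3) := by
    rw [← hcard, ← smul_eq_mul]
    exact sum_le_card_nsmul _ _ _ hle
  have h3 : ∑ x ∈ I, 2 * #{s ∈ S | x ∈ R s} ≤ ∑ x ∈ I, ((#{s ∈ S | x ∈ R s}).choose 2 + 3) :=
    sum_le_sum fun x _ => two_mul_le_choose_two_add_three _
  have h4 : ∑ x ∈ I, 3 * #{s ∈ S | x ∈ R s} ≤ ∑ x ∈ I, ((#{s ∈ S | x ∈ R s}).choose 2 + 6) :=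
    sum_le_sum fun x _ => three_mul_le_choose_two_add_six _
  rw [← mul_sum, sum_add_distrib, sum_const, smul_eq_mul, hq, hIc] at h3 h4
  obtain hS | hS | hS : S.card = 6 ∨ S.card = 7 ∨ S.card = 8 := by omega
  · rw [hS, show Nat.choose 6 2 = 15 from rfl] at h2
    rw [hS] at h3 hIc
    omega
  · rw [hS, show Nat.choose 7 2 = 21 from rfl] at h2
    rw [hS] at h4 hIc
    omega
  · obtain ⟨x, -, hx⟩ : ∃ x ∈ I, 3 ≤ #{s ∈ S | x ∈ R s} := by
      by_contra! hcon
      have h5 := sum_le_card_nsmul I (fun x => #{s ∈ S | x ∈ R s}) 2 fun x hx => by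
        have := hcon x hx
        omega
      rw [hq, hIc, hS, smul_eq_mul] at h5
      omega
    obtain ⟨T, hT, hT5⟩ := h.exists_missCount_lt_five (I := I) hD hR
      (fun s hs => by rw [hRc s hs, hS]) hx
    have h5 := sum_lt_sum hle ⟨T, hT, by rw [hS]; exact hT5⟩
    rw [sum_const, hcard, smul_eq_mul] at h5
    rw [hS, show Nat.choose 8 2 = 28 from rfl] at h5
    rw [hS] at h4 hIc
    omega

/-! ### Cut sets of size five -/

/-- If seven components are left, a pair leaving `S` belongs to a singleton component, and its
member in `S` is adjacent in `H` to that vertex and to precisely one further component. -/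
lemma exists_adj_iff_of_not_pair_subset (h : IsCriticalBarrier H S f D)
    (hI : ∀ z ∉ S, ∃ I, IsPartialTransversal S f I ∧ z ∈ I ∧ I.card = 7) {v : V}
    (hv : ¬ D v ⊆ S) :
    v ∉ S ∧ (∀ x ∉ S, f x = f v → x = v) ∧
      ∃ s ∈ S, ∃ z ∉ S, ∀ x ∉ S, H.Adj s x ↔ x = v ∨ f x = f z := by
  obtain ⟨y, -, hy⟩ := not_subset.1 hv
  obtain ⟨J, hJ, -, hJc⟩ := hI y hy
  obtain ⟨s, hs, z, hz, hD⟩ := h.pair_eq_of_not_subset hJ (by omega) hv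
  have hmem : ∀ I, IsPartialTransversal S f I → I.card = 7 → v ∈ I := by
    intro I hI hIc
    have h1 := h.card_filter_adj_le hI hz hD
    have h2 := h.card_le_card_filter_add_five hI hs
    obtain ⟨x, hx⟩ : {x ∈ I | x = v}.Nonempty := card_pos.1 (by omega)
    obtain ⟨hxI, rfl⟩ := mem_filter.1 hx
    exact hxI
  have hsv : H.Adj s v := h.adj_of_mem (by rw [hD]; simp)
  refine ⟨hJ.1 v (hmem J hJ hJc), ?_, s, hs, z, hz, ?_⟩
  · intro x hx hxv
    obtain ⟨I, hI, hxI, hIc⟩ := hI x hx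
    exact hI.2 x hxI v (hmem I hI hIc) hxv
  · intro x hx
    refine ⟨fun hsx => ?_, ?_⟩
    · by_contra! hcon
      exact h.not_adj_of_label_ne hz hD hx hcon.2 hcon.1 hsx
    · rintro (rfl | hxz)
      · exact hsv
      obtain ⟨I, hI, hxI, hIc⟩ := hI x hx
      by_contra hsx
      have h2 := h.card_le_card_filter_add_five hI hs
      have h3 : {y ∈ I | H.Adj s y} ⊆ {v} := by
        intro y hy
        obtain ⟨hyI, hsy⟩ := mem_filter.1 hy
        rw [mem_singleton]
        by_contra hyv
        refine h.not_adj_of_label_ne hz hD (hI.1 y hyI) (fun hyz => ?_) hyv hsy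
        exact hsx (hI.2 y hyI x hxI (hyz.trans hxz.symm) ▸ hsy)
      have h4 := card_le_card h3
      rw [card_singleton] at h4
      omega

/-- The configuration of one component `C` and six singleton components `U`. -/
lemma not_card_eq_five_of_singletons (h : IsCriticalBarrier H S f D) (hS : S.card = 5)
    (hI : ∀ z ∉ S, ∃ I, IsPartialTransversal S f I ∧ z ∈ I ∧ I.card = 7) {C U : Finset V}
    {c : α} (hC : ∀ x, x ∈ C ↔ x ∉ S ∧ f x = c) (hU : ∀ x, x ∈ U ↔ x ∉ S ∧ f x ≠ c)
    (hUinj : ∀ x ∈ U, ∀ y ∈ U, f x = f y → x = y) (hCc : 3 ≤ C.card) (hUc : U.card = 6) :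
    False := by
  have hA : ∀ v, ¬ D v ⊆ S → v ∈ U := by
    intro v hv
    obtain ⟨hvS, hv1, -⟩ := h.exists_adj_iff_of_not_pair_subset hI hv
    refine (hU v).2 ⟨hvS, fun hvc => ?_⟩
    have h1 : C ⊆ {v} := fun x hx => mem_singleton.2
      (hv1 x ((hC x).1 hx).1 (((hC x).1 hx).2.trans hvc.symm))
    have h2 := card_le_card h1
    rw [card_singleton] at h2
    omega
  have hCU : Disjoint C U := disjoint_left.2 fun x hx hx' => ((hU x).1 hx').2 ((hC x).1 hx).2
  have hSC : Disjoint S C := disjoint_left.2 fun x hx hx' => ((hC x).1 hx').1 hx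
  have hSU : Disjoint S U := disjoint_left.2 fun x hx hx' => ((hU x).1 hx').1 hx
  let N : V → Finset V := fun s => {x ∈ U | H.Adj s x}
  let P : Finset V := {s ∈ S | (∀ x ∈ C, ¬ H.Adj s x) ∧ (N s).card ≤ 2}
  let Z : Finset V := {s ∈ S | (∀ x ∈ C, H.Adj s x) ∧ (N s).card ≤ 1}
  let A : Finset V := {v ∈ U | ¬ D v ⊆ S}
  let E : Finset V := {v ∈ U | D v ⊆ S}
  have hPS : P ⊆ S := filter_subset _ _
  have hZS : Z ⊆ S := filter_subset _ _
  have hEU : E ⊆ U := filter_subset _ _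
  have hAE : E.card + A.card = 6 := hUc ▸ card_filter_add_card_filter_not _
  have hAsub : A ⊆ P.biUnion N ∪ Z.biUnion N := by
    intro v hv
    obtain ⟨hvU, hvD⟩ := mem_filter.1 hv
    obtain ⟨-, -, s, hs, z, hz, hsz⟩ := h.exists_adj_iff_of_not_pair_subset hI hvD
    have hvN : v ∈ N s := mem_filter.2 ⟨hvU, (hsz v ((hU v).1 hvU).1).2 (.inl rfl)⟩
    rw [mem_union, mem_biUnion, mem_biUnion]
    by_cases hzc : f z = c
    · refine .inr ⟨s, mem_filter.2 ⟨hs, fun x hx => ?_, ?_⟩, hvN⟩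
      · exact (hsz x ((hC x).1 hx).1).2 (.inr (((hC x).1 hx).2.trans hzc.symm))
      · refine (card_le_card (t := {v}) fun x hx => ?_).trans (card_singleton v).le
        obtain ⟨hxU, hsx⟩ := mem_filter.1 hx
        rcases (hsz x ((hU x).1 hxU).1).1 hsx with rfl | hxz
        · exact mem_singleton_self _
        · exact absurd (hxz.trans hzc) ((hU x).1 hxU).2
    · refine .inl ⟨s, mem_filter.2 ⟨hs, fun x hx hsx => ?_, ?_⟩, hvN⟩
      · obtain ⟨hxS, hxc⟩ := (hC x).1 hx
        rcases (hsz x hxS).1 hsx with rfl | hxz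
        · exact ((hU x).1 hvU).2 hxc
        · exact hzc (hxz.symm.trans hxc)
      · refine (card_le_card (t := {v, z}) fun x hx => ?_).trans Finset.card_le_two
        obtain ⟨hxU, hsx⟩ := mem_filter.1 hx
        rw [mem_insert, mem_singleton]
        exact ((hsz x ((hU x).1 hxU).1).1 hsx).imp_right
          (hUinj x hxU z ((hU z).2 ⟨hz, hzc⟩))
  have hPN : (P.biUnion N).card ≤ P.card * 2 :=
    card_biUnion_le_card_mul P N 2 fun s hs => (mem_filter.1 hs).2.2
  have hZN : (Z.biUnion N).card ≤ Z.card * 1 :=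
    card_biUnion_le_card_mul Z N 1 fun s hs => (mem_filter.1 hs).2.2
  have hAc := (card_le_card hAsub).trans (card_union_le _ _)
  have hpairs : 5 + C.card + E.card + Z.card.choose 2 ≤ 10 := by
    have h1 : (S ∪ C ∪ E).card = 5 + C.card + E.card := by
      rw [card_union_of_disjoint, card_union_of_disjoint hSC, hS]
      rw [disjoint_union_left]
      exact ⟨hSU.mono_right hEU, hCU.mono_right hEU⟩
    have h2 : Disjoint ((S ∪ C ∪ E).image D) (Z.powersetCard 2) := by
      rw [Finset.disjoint_left]
      rintro _ hT hTZ
      obtain ⟨w, -, rfl⟩ := mem_image.1 hT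
      have h3 : C ⊆ {w} := fun x hx => mem_singleton.2 <| h.eq_of_forall_adj fun p hp =>
        (mem_filter.1 ((mem_powersetCard.1 hTZ).1 hp)).2.1 x hx
      have h4 := card_le_card h3
      rw [card_singleton] at h4
      omega
    have h3 : (S ∪ C ∪ E).image D ∪ Z.powersetCard 2 ⊆ S.powersetCard 2 := by
      apply union_subset _ (powersetCard_mono hZS)
      rintro _ hT
      obtain ⟨w, hw, rfl⟩ := mem_image.1 hT
      refine mem_powersetCard.2 ⟨?_, h.card_pair w⟩
      by_contra hwS
      have hwU := hA w hwS
      rw [mem_union, mem_union] at hw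
      rcases hw with (hw | hw) | hw
      · exact disjoint_left.1 hSU hw hwU
      · exact disjoint_left.1 hCU hw hwU
      · exact hwS (mem_filter.1 hw).2
    have h4 := card_le_card h3
    rw [card_union_of_disjoint h2, card_image_of_injective _ h.pair_injective, h1,
      card_powersetCard, card_powersetCard, hS] at h4
    exact h4
  have hCW : ∀ x ∈ C, D x ⊆ S \ P := by
    intro x hx p hp
    have hxS : D x ⊆ S := by
      by_contra hcon
      exact disjoint_left.1 hCU hx (hA x hcon)
    exact mem_sdiff.2 ⟨hxS hp, fun hpP => (mem_filter.1 hpP).2.1 x hx (h.adj_of_mem hp)⟩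
  have hWc : (S \ P).card = 5 - P.card := by rw [card_sdiff_of_subset hPS, hS]
  have hCP := h.card_le_choose_of_pair_subset hCW
  rw [hWc] at hCP
  have hP5 : P.card ≤ 5 := hS ▸ card_le_card hPS
  have hZ5 : Z.card ≤ 5 := hS ▸ card_le_card hZS
  have harith : ∀ p ≤ 5, ∀ z ≤ 5, ∀ e ≤ 2, ∀ l ≤ 5, 3 ≤ l → 6 ≤ e + (p * 2 + z * 1) →
      5 + l + e + z.choose 2 ≤ 10 → l ≤ (5 - p).choose 2 → p = 2 ∧ l = 3 := by
    intro p hp z hz e he l hl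
    interval_cases p <;> interval_cases z <;> norm_num [Nat.choose] <;> omega
  obtain ⟨hP2, hC3⟩ := harith P.card hP5 Z.card hZ5 E.card (by omega) C.card (by omega) hCc
    (by omega) hpairs hCP
  have himage : C.image D = (S \ P).powersetCard 2 := by
    apply eq_of_subset_of_card_le
    · intro T hT
      obtain ⟨x, hx, rfl⟩ := mem_image.1 hT
      exact mem_powersetCard.2 ⟨hCW x hx, h.card_pair x⟩
    · rw [card_powersetCard, hWc, hP2, card_image_of_injective _ h.pair_injective, hC3]
      decide
  have hsurj : ∀ T ⊆ S \ P, T.card = 2 → ∃ x ∈ C, D x = T := fun T hT hTc =>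
    mem_image.1 (himage ▸ mem_powersetCard.2 ⟨hT, hTc⟩)
  have hZ0 : Z = ∅ := by
    rw [eq_empty_iff_forall_notMem]
    intro d hd
    have hdW : d ∈ S \ P := by
      refine mem_sdiff.2 ⟨hZS hd, fun hdP => ?_⟩
      obtain ⟨x, hx⟩ : C.Nonempty := card_pos.1 (by omega)
      exact (mem_filter.1 hdP).2.1 x hx ((mem_filter.1 hd).2.1 x hx)
    obtain ⟨w, hw, hDw⟩ := hsurj ((S \ P).erase d) (erase_subset _ _)
      (by rw [card_erase_of_mem hdW, hWc, hP2])
    obtain ⟨e, he⟩ : (D w).Nonempty := card_pos.1 (by rw [h.card_pair]; omega)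
    have he' := he
    rw [hDw, mem_erase] at he'
    obtain ⟨x, -, hDx⟩ := hsurj {d, e} (by
      intro p hp
      rw [mem_insert, mem_singleton] at hp
      rcases hp with rfl | rfl
      · exact hdW
      · exact he'.2) (Finset.card_pair he'.1.symm)
    have hwx : w = x := by
      apply h.eq_of_forall_adj
      intro p hp
      rw [hDx, mem_insert, mem_singleton] at hp
      rcases hp with rfl | rfl
      · exact (mem_filter.1 hd).2.1 w hw
      · exact h.adj_of_mem he
    have hdD : d ∈ D w := by rw [hwx, hDx]; simp
    rw [hDw] at hdD
    exact ne_of_mem_erase hdD rfl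
  rw [hZ0, biUnion_empty, union_empty] at hAsub
  rw [hP2] at hPN
  rw [hZ0, card_empty] at hZN
  have hAeq := eq_of_subset_of_card_le hAsub (by omega)
  obtain ⟨u, hu⟩ : E.Nonempty := card_pos.1 (by have := card_le_card hAsub; omega)
  obtain ⟨huU, huS⟩ := mem_filter.1 hu
  obtain ⟨x, hx, hDx⟩ := hsurj (D u) (fun p hp => mem_sdiff.2 ⟨huS hp, fun hpP => by
    have huA : u ∈ A := hAeq ▸ mem_biUnion.2 ⟨p, hpP, mem_filter.2 ⟨huU, h.adj_of_mem hp⟩⟩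
    exact (mem_filter.1 huA).2 huS⟩) (h.card_pair u)
  exact disjoint_left.1 hCU hx (h.pair_injective hDx ▸ huU)

lemma not_card_eq_five [Fintype V] (h : IsCriticalBarrier H S f D) (hS : S.card = 5)
    (heven : Even (Fintype.card V)) (h12 : Fintype.card V ≠ 12) {L : Finset α}
    (hL : 7 ≤ L.card) (hodd : ∀ a ∈ L, Odd #{x ∈ Sᶜ | f x = a}) : False := by
  have hLpos : ∀ a ∈ L, 1 ≤ #{x ∈ Sᶜ | f x = a} := fun a ha => (hodd a ha).pos
  have hLex : ∀ a ∈ L, ∃ x ∉ S, f x = a := by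
    intro a ha
    obtain ⟨x, hx⟩ := card_pos.1 (hLpos a ha)
    exact ⟨x, mem_compl.1 (mem_filter.1 hx).1, (mem_filter.1 hx).2⟩
  have hSc : Sᶜ.card = Fintype.card V - 5 := by rw [card_compl, hS]
  have h14 : 14 ≤ Fintype.card V := by
    have h1 : L ⊆ Sᶜ.image f := fun a ha => by
      obtain ⟨x, hx, hxa⟩ := hLex a ha
      exact mem_image.2 ⟨x, mem_compl.2 hx, hxa⟩
    have h2 := (card_le_card h1).trans card_image_le
    rcases heven with ⟨m, hm⟩
    omega
  obtain ⟨v₀, hv₀⟩ : ∃ v, ¬ D v ⊆ S := by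
    by_contra! hcon
    have h1 := h.card_le_choose_of_pair_subset (A := univ) fun v _ => hcon v
    rw [card_univ, hS, show Nat.choose 5 2 = 10 from rfl] at h1
    omega
  have hmain : ∀ z ∉ S, f z ∈ L ∧ L.card = 7 ∧
      ∃ I, IsPartialTransversal S f I ∧ z ∈ I ∧ I.card = 7 := by
    intro z hz
    obtain ⟨I, hI, hzI, him⟩ := exists_partialTransversal_image_eq hLex hz
    have hIc : I.card = (insert (f z) L).card := by
      rw [← him, card_image_of_injOn]
      exact fun x hx y hy => hI.2 x hx y hy
    have h7 : I.card ≤ 7 := by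
      by_contra! h8
      exact hv₀ (h.pair_subset_of_eight_le hI h8 v₀)
    have hfz : f z ∈ L := by
      by_contra hfz
      rw [card_insert_of_notMem hfz] at hIc
      omega
    rw [insert_eq_of_mem hfz] at hIc
    exact ⟨hfz, by omega, I, hI, hzI, by omega⟩
  have hI := fun z hz => (hmain z hz).2.2
  have hL7 : L.card = 7 := by
    obtain ⟨z, -, hz⟩ := not_subset.1 hv₀
    exact (hmain z hz).2.1
  have hsum : Sᶜ.card = ∑ a ∈ L, #{x ∈ Sᶜ | f x = a} :=
    card_eq_sum_card_fiberwise fun x hx => (hmain x (mem_compl.1 hx)).1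
  have hbig : ∀ a, 2 ≤ #{x ∈ Sᶜ | f x = a} → ∀ x ∉ S, f x = a → D x ⊆ S := by
    intro a ha x hx hxa
    by_contra hxS
    obtain ⟨-, h1, -⟩ := h.exists_adj_iff_of_not_pair_subset hI hxS
    have h2 : {y ∈ Sᶜ | f y = a} ⊆ {x} := fun y hy => by
      obtain ⟨hyS, hya⟩ := mem_filter.1 hy
      exact mem_singleton.2 (h1 y (mem_compl.1 hyS) (hya.trans hxa.symm))
    have h3 := card_le_card h2
    rw [card_singleton] at h3
    omega
  have hge : ∀ a ∈ L, #{x ∈ Sᶜ | f x = a} ≠ 1 → 3 ≤ #{x ∈ Sᶜ | f x = a} := by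
    intro a ha hne
    obtain ⟨m, hm⟩ := hodd a ha
    omega
  obtain ⟨c, hcL, hc⟩ : ∃ c ∈ L, #{x ∈ Sᶜ | f x = c} ≠ 1 := by
    by_contra! hcon
    rw [sum_congr rfl hcon, sum_const, hL7, smul_eq_mul] at hsum
    omega
  have hc3 := hge c hcL hc
  have hsingle : ∀ a ∈ L.erase c, #{x ∈ Sᶜ | f x = a} = 1 := by
    intro a ha
    obtain ⟨hac, haL⟩ := mem_erase.1 ha
    by_contra hne
    have ha3 := hge a haL hne
    have hd1 : Disjoint {x ∈ Sᶜ | f x = c} {x ∈ Sᶜ | f x = a} := disjoint_left.2 fun x hx hx' =>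
      hac ((mem_filter.1 hx').2.symm.trans (mem_filter.1 hx).2)
    have hd2 : Disjoint S ({x ∈ Sᶜ | f x = c} ∪ {x ∈ Sᶜ | f x = a}) := by
      rw [← filter_or]
      exact disjoint_left.2 fun x hx hx' => mem_compl.1 (mem_filter.1 hx').1 hx
    have h1 := h.card_le_choose_of_pair_subset
      (A := S ∪ ({x ∈ Sᶜ | f x = c} ∪ {x ∈ Sᶜ | f x = a})) (T := S) ?_
    · rw [card_union_of_disjoint hd2, card_union_of_disjoint hd1, hS,
        show Nat.choose 5 2 = 10 from rfl] at h1
      omega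
    · intro x hx
      rw [mem_union, mem_union, mem_filter, mem_filter, mem_compl] at hx
      rcases hx with hx | hx | hx
      · by_contra hxS
        exact (h.exists_adj_iff_of_not_pair_subset hI hxS).1 hx
      · exact hbig c (by omega) x hx.1 hx.2
      · exact hbig a (by omega) x hx.1 hx.2
  have hUc : #{x ∈ Sᶜ | f x ≠ c} = 6 := by
    rw [← add_sum_erase L _ hcL, sum_congr rfl hsingle, sum_const, card_erase_of_mem hcL, hL7,
      smul_eq_mul] at hsum
    have hadd : #{x ∈ Sᶜ | f x = c} + #{x ∈ Sᶜ | f x ≠ c} = Sᶜ.card :=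
      card_filter_add_card_filter_not _
    omega
  refine h.not_card_eq_five_of_singletons hS hI (C := {x ∈ Sᶜ | f x = c})
    (U := {x ∈ Sᶜ | f x ≠ c}) (c := c) (by simp) (by simp) ?_ hc3 hUc
  intro x hx y hy hxy
  rw [mem_filter, mem_compl] at hx hy
  have h1 := hsingle (f x) (mem_erase.2 ⟨hx.2, (hmain x hx.1).1⟩)
  exact card_le_one.1 h1.le x (by simp [hx.1]) y (by simp [hy.1, hxy])

/-- Few odd components are left by a cut set. -/
lemma card_lt_card_add_two [Fintype V] (h : IsCriticalBarrier H S f D)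
    (heven : Even (Fintype.card V)) (h12 : Fintype.card V ≠ 12) {L : Finset α}
    (hodd : ∀ a ∈ L, Odd #{x ∈ Sᶜ | f x = a}) : L.card < S.card + 2 := by
  by_contra! hL
  have hLex : ∀ a ∈ L, ∃ x ∉ S, f x = a := by
    intro a ha
    obtain ⟨x, hx⟩ := card_pos.1 (hodd a ha).pos
    exact ⟨x, mem_compl.1 (mem_filter.1 hx).1, (mem_filter.1 hx).2⟩
  have hI : ∀ z ∉ S, ∃ I, IsPartialTransversal S f I ∧ z ∈ I ∧ I.card = S.card + 2 :=
    fun z hz => exists_partialTransversal_card_eq hLex hz (by omega) hL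
  obtain ⟨a, ha, b, hb, hab⟩ := one_lt_card.1 (show 1 < L.card by omega)
  obtain ⟨v, hv, hva⟩ := hLex a ha
  obtain ⟨w, -, hwb⟩ := hLex b hb
  obtain ⟨I, hIt, -, hIc⟩ := hI v hv
  have h6 := h.card_lt_six hIt hIc
  interval_cases hS : S.card
  · exact h.not_card_eq_zero hS heven (v := v) (w := w) (by rwa [hva, hwb])
  · exact h.not_card_eq_one hS hIt hIc.ge
  · exact h.not_card_eq_two hS hIt hIc.ge
  · exact h.not_card_eq_three hS heven hI
  · exact h.not_card_eq_four hS hI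
  · exact h.not_card_eq_five hS heven h12 hL hodd

end IsCriticalBarrier

/-! ### From graphs to barriers -/

lemma exists_forall_not_adj_of_ncard_lt_domNum {G : SimpleGraph V} {A : Set V}
    (hA : A.ncard < domNum G) : ∃ u, u ∉ A ∧ ∀ p ∈ A, ¬ G.Adj p u := by
  by_contra! hcon
  have h : domNum G ≤ A.ncard := Nat.sInf_le ⟨A, fun v => by
    by_cases hv : v ∈ A
    · exact .inl hv
    · exact .inr (hcon v hv), rfl⟩
  omega

/-- In the complement of a `3`-`γ`-vertex-critical graph, every vertex is the only common neighbor
of some pair of vertices. -/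
lemma exists_pair_forall_compl_adj_iff [Finite V] {G : SimpleGraph V} (hcrit : GammaCritical G 3)
    (v : V) : ∃ P : Finset V, P.card = 2 ∧ ∀ u, (∀ p ∈ P, Gᶜ.Adj p u) ↔ u = v := by
  obtain ⟨A, ⟨-, hdom⟩, hAc⟩ := Nat.sInf_mem (s := {n | ∃ D : Set V,
    IsDomSetAvoiding G v D ∧ D.ncard = n}) ⟨_, {v}ᶜ, ⟨by simp, fun w hw => .inl hw⟩, rfl⟩
  have hA3 : A.ncard < 3 := hAc ▸ hcrit.2 v
  have hcompl : ∀ B : Set V, B.ncard < 3 → ∃ u ∉ B, ∀ p ∈ B, Gᶜ.Adj p u := by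
    intro B hB
    obtain ⟨u, huB, hu⟩ := exists_forall_not_adj_of_ncard_lt_domNum (A := B) (by rwa [hcrit.1])
    exact ⟨u, huB, fun p hp => (compl_adj _ _ _).2 ⟨fun hpu => huB (hpu ▸ hp), hu p hp⟩⟩
  have huniq : ∀ u, (∀ p ∈ A, Gᶜ.Adj p u) → u = v := by
    intro u hu
    by_contra huv
    rcases hdom u huv with h | ⟨p, hp, hpu⟩
    · exact Gᶜ.irrefl (hu u h)
    · exact ((compl_adj _ _ _).1 (hu p hp)).2 hpu
  have hadj : ∀ p ∈ A, Gᶜ.Adj p v := by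
    obtain ⟨u, -, hu⟩ := hcompl A hA3
    rwa [huniq u hu] at hu
  have hA2 : A.ncard = 2 := by
    by_contra hne
    obtain ⟨u, huB, hu⟩ := hcompl (insert v A) ((Set.ncard_insert_le v A).trans_lt (by omega))
    exact huB (huniq u (fun p hp => hu p (.inr hp)) ▸ Set.mem_insert v A)
  refine ⟨A.toFinite.toFinset, by rw [← Set.ncard_eq_toFinset_card, hA2], fun u => ?_⟩
  simp only [Set.Finite.mem_toFinset]
  exact ⟨huniq u, by rintro rfl; exact hadj⟩

lemma exists_isCriticalBarrier_compl [Finite V] {G : SimpleGraph V} (hcrit : GammaCritical G 3)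
    (hfree : StarFree G 6) {S : Finset V} {f : V → α}
    (hf : ∀ x ∉ S, ∀ y ∉ S, G.Adj x y → f x = f y) : ∃ D, IsCriticalBarrier Gᶜ S f D := by
  choose D hD2 hD using exists_pair_forall_compl_adj_iff hcrit
  refine ⟨D, ⟨fun p q => ?_, hD2, hD, fun c T hc hT => ?_, fun x hx y hy hxy => ?_⟩⟩
  · obtain ⟨u, hu, hpq⟩ := exists_forall_not_adj_of_ncard_lt_domNum (G := G) (A := {p, q})
      ((Set.ncard_insert_le p {q}).trans_lt (by rw [Set.ncard_singleton, hcrit.1]; omega))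
    rw [Set.mem_insert_iff, Set.mem_singleton_iff, not_or] at hu
    exact ⟨u, (compl_adj _ _ _).2 ⟨Ne.symm hu.1, hpq p (by simp)⟩,
      (compl_adj _ _ _).2 ⟨Ne.symm hu.2, hpq q (by simp)⟩⟩
  · by_contra! h6
    obtain ⟨T', hT', hT'c⟩ := exists_subset_card_eq (show 6 ≤ T.card from h6)
    refine hfree ⟨c, T', hT'c, fun t ht => ?_, fun t ht t' ht' hne => ?_⟩
    · by_contra hct
      exact (hc t (hT' ht)).2 ((compl_adj _ _ _).2 ⟨(hc t (hT' ht)).1, hct⟩)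
    · exact ((compl_adj _ _ _).1 (hT t (hT' ht) t' (hT' ht') hne)).2
  · refine (compl_adj _ _ _).2 ⟨?_, fun h => hxy (hf x hx y hy h)⟩
    rintro rfl
    exact hxy rfl

/-- In a graph of even order, a Tutte violator leaves two more odd components than it has vertices,
as both numbers have the same parity. -/
lemma SimpleGraph.IsTutteViolator.ncard_add_two_le [Finite V] {G : SimpleGraph V}
    (heven : Even (Nat.card V)) {u : Set V} (hu : G.IsTutteViolator u) :
    u.ncard + 2 ≤ ((⊤ : G.Subgraph).deleteVerts u).coe.oddComponents.ncard := by
  have h1 := odd_ncard_oddComponents ((⊤ : G.Subgraph).deleteVerts u).coe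
  have h2 : Nat.card ((⊤ : G.Subgraph).deleteVerts u).verts + u.ncard = Nat.card V := by
    rw [Subgraph.deleteVerts_verts, Subgraph.verts_top, ← Set.compl_eq_univ_sdiff,
      Nat.card_coe_set_eq, add_comm, Set.ncard_add_ncard_compl]
  have h3 : u.ncard < ((⊤ : G.Subgraph).deleteVerts u).coe.oddComponents.ncard := hu
  grind

lemma SimpleGraph.IsTutteViolator.false_of_critical [Fintype V] {G : SimpleGraph V}
    (hcrit : GammaCritical G 3) (heven : Even (Fintype.card V)) (h12 : Fintype.card V ≠ 12)
    (hfree : StarFree G 6) {u : Set V} (hu : G.IsTutteViolator u) : False := by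
  have hle := hu.ncard_add_two_le (by rwa [Nat.card_eq_fintype_card])
  set K := (⊤ : G.Subgraph).deleteVerts u with hK
  have hmem : ∀ x, x ∈ K.verts ↔ x ∉ u := by simp [hK]
  let f : V → Option K.coe.ConnectedComponent := fun x =>
    if hx : x ∈ K.verts then some (K.coe.connectedComponentMk ⟨x, hx⟩) else none
  have hfx : ∀ x (hx : x ∈ K.verts), f x = some (K.coe.connectedComponentMk ⟨x, hx⟩) :=
    fun x hx => dif_pos hx
  obtain ⟨D, hD⟩ := exists_isCriticalBarrier_compl hcrit hfree (S := u.toFinset) (f := f) (by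
    intro x hx y hy hxy
    rw [Set.mem_toFinset, ← hmem] at hx hy
    rw [hfx x hx, hfx y hy]
    congr 1
    refine ConnectedComponent.sound (Adj.reachable ?_)
    simp only [Subgraph.coe_adj]
    rw [hK, Subgraph.deleteVerts_adj]
    exact ⟨trivial, (hmem x).1 hx, trivial, (hmem y).1 hy, hxy⟩)
  have hcomp : ∀ c : K.coe.ConnectedComponent,
      #{x ∈ u.toFinsetᶜ | f x = some c} = c.supp.ncard := by
    intro c
    rw [← Set.ncard_image_of_injective c.supp Subtype.val_injective, ← Set.ncard_coe_finset]
    congr 1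
    ext x
    simp only [coe_filter, mem_compl, Set.mem_toFinset, Set.mem_ofPred_eq, Set.mem_image,
      Subtype.exists, exists_and_right, exists_eq_right, ConnectedComponent.mem_supp_iff]
    rw [← hmem]
    constructor
    · rintro ⟨hx, hxc⟩
      rw [hfx x hx] at hxc
      exact ⟨hx, Option.some_injective _ hxc⟩
    · rintro ⟨hx, hxc⟩
      exact ⟨hx, by rw [hfx x hx, hxc]⟩
  have hlt := hD.card_lt_card_add_two heven h12
    (L := K.coe.oddComponents.toFinite.toFinset.image some) (by
      intro a ha
      obtain ⟨c, hc, rfl⟩ := mem_image.1 ha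
      rw [Set.Finite.mem_toFinset] at hc
      have hodd : Odd c.supp.ncard := hc
      rw [← hcomp] at hodd
      convert hodd)
  rw [card_image_of_injective _ (Option.some_injective _), ← Set.ncard_eq_toFinset_card,
    ← Set.ncard_eq_toFinset_card'] at hlt
  omega

end CriticalBarrier

/-- A `3`-`γ`-vertex-critical `K_{1,6}`-free graph of even order `≠ 12`
has a perfect matching. -/
theorem three_gamma_critical_K16_free_even_perfectMatching
    {V : Type*} [Fintype V] (G : SimpleGraph V)
    (hcrit : GammaCritical G 3) (heven : Even (Fintype.card V))
    (h12 : Fintype.card V ≠ 12) (hfree : StarFree G 6) :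
    HasPerfectMatching G :=
  tutte.2 fun _ hu => hu.false_of_critical hcrit heven h12 hfree
end

section
/- Let G be a 3-γ-vertex-critical graph of odd order such that G − ∅ has exactly one component of odd order (c_o(G) = 1) and |V(G)| ≠ 13. If G is K_{1,7}-free, then either G has a near perfect matching, or |V(G)| = 9, or |V(G)| = 15. (The paper shows the exceptions are exactly one specific 9-vertex graph and two specific 15-vertex graphs.) -/
open SimpleGraph

noncomputable section

open scoped Classical
open Finset

/-- A barrier of deficiency three in a graph all of whose vertices `v` are critical: the vertices
outside `S` are split into `#S + 3` mutually nonadjacent classes of odd size, and the pair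
`{X v, Y v}`, with `X v ∈ S`, dominates every vertex except `v`. -/
structure CriticalBarrier {V : Type*} [Fintype V] (G : SimpleGraph V) (κ : Type*) where
  S : Finset V
  cls : V → κ
  T : Finset κ
  cls_mem : ∀ v ∉ S, cls v ∈ T
  odd_class : ∀ c ∈ T, Odd #{v | v ∉ S ∧ cls v = c}
  cls_eq : ∀ u v, u ∉ S → v ∉ S → G.Adj u v → cls u = cls v
  card_T : #T = #S + 3
  X : V → V
  Y : V → V
  X_mem : ∀ v, X v ∈ S
  X_ne_Y : ∀ v, X v ≠ Y v
  X_ne : ∀ v, X v ≠ v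
  Y_ne : ∀ v, Y v ≠ v
  not_adj_X : ∀ v, ¬ G.Adj (X v) v
  not_adj_Y : ∀ v, ¬ G.Adj (Y v) v
  dominates : ∀ v w, w ≠ v → w = X v ∨ w = Y v ∨ G.Adj (X v) w ∨ G.Adj (Y v) w
  starFree : StarFree G 7

namespace CriticalBarrier

variable {V κ : Type*} [Fintype V] {G : SimpleGraph V} (P : CriticalBarrier G κ)

/-- The vertices outside the barrier that are not adjacent to `x`. -/
def Z (x : V) : Finset V := {w | w ∉ P.S ∧ ¬ G.Adj x w}

/-- The vertices outside the barrier in class `c`. -/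
def fiber (c : κ) : Finset V := {v | v ∉ P.S ∧ P.cls v = c}

/-- The classes without a neighbour of `x`. -/
def F (x : V) : Finset κ := {c ∈ P.T | P.fiber c ⊆ P.Z x}

/-- The pair dominating everything but `v`. -/
def e (v : V) : Finset V := {P.X v, P.Y v}

/-- The vertices outside the barrier whose dominating pair has `x` as its only barrier vertex. -/
def B (x : V) : Finset V := {v | v ∉ P.S ∧ P.X v = x ∧ P.Y v ∉ P.S}

/-- The nonneighbours of `x` outside the barrier lie in a single class. -/
def IsConcentrated (x : V) : Prop := ∃ c, ∀ z ∈ P.Z x, P.cls z = c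

lemma mem_Z {x w : V} : w ∈ P.Z x ↔ w ∉ P.S ∧ ¬ G.Adj x w := by simp [Z]

lemma mem_fiber {c : κ} {w : V} : w ∈ P.fiber c ↔ w ∉ P.S ∧ P.cls w = c := by simp [fiber]

lemma mem_B {x v : V} : v ∈ P.B x ↔ v ∉ P.S ∧ P.X v = x ∧ P.Y v ∉ P.S := by simp [B]

lemma fiber_nonempty {c : κ} (hc : c ∈ P.T) : (P.fiber c).Nonempty :=
  card_pos.1 (P.odd_class c hc).pos

lemma mem_Z_X {v : V} (hv : v ∉ P.S) : v ∈ P.Z (P.X v) := P.mem_Z.2 ⟨hv, P.not_adj_X v⟩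

lemma mem_Z_Y {v : V} (hv : v ∉ P.S) : v ∈ P.Z (P.Y v) := P.mem_Z.2 ⟨hv, P.not_adj_Y v⟩

lemma eq_or_cls_eq {v z : V} (hY : P.Y v ∉ P.S) (hz : z ∈ P.Z (P.X v)) :
    z = v ∨ P.cls z = P.cls (P.Y v) := by
  rw [mem_Z] at hz
  by_contra! h
  rcases P.dominates v z h.1 with h1 | h1 | h1 | h1
  · exact hz.1 (h1 ▸ P.X_mem v)
  · exact h.2 (by rw [h1])
  · exact hz.2 h1
  · exact h.2 (P.cls_eq _ _ hY hz.1 h1).symm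

lemma eq_of_mem_Z {v z : V} (hY : P.Y v ∈ P.S) (hX : z ∈ P.Z (P.X v)) (hY' : z ∈ P.Z (P.Y v)) :
    z = v := by
  rw [mem_Z] at hX hY'
  by_contra! h
  rcases P.dominates v z h with h1 | h1 | h1 | h1
  · exact hX.1 (h1 ▸ P.X_mem v)
  · exact hX.1 (h1 ▸ hY)
  · exact hX.2 h1
  · exact hY'.2 h1

lemma eq_of_mem_Z_of_e_eq {v x y z : V} (hY : P.Y v ∈ P.S) (he : P.e v = {x, y})
    (hx : z ∈ P.Z x) (hy : z ∈ P.Z y) : z = v := by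
  have h1 : P.X v ∈ ({x, y} : Finset V) := he ▸ by simp [e]
  have h2 : P.Y v ∈ ({x, y} : Finset V) := he ▸ by simp [e]
  refine P.eq_of_mem_Z hY ?_ ?_
  · grind
  · grind

lemma e_injective : Function.Injective P.e := by
  intro v w h
  by_contra hne
  have key : ∀ u ∈ P.e w, u ≠ w ∧ ¬ G.Adj u w := by
    simp [e, P.X_ne, P.Y_ne, P.not_adj_X, P.not_adj_Y]
  rw [← h] at key
  have h1 := key (P.X v) (by simp [e])
  have h2 := key (P.Y v) (by simp [e])
  rcases P.dominates v w (Ne.symm hne) with h3 | h3 | h3 | h3 <;> grind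

lemma e_mem_powersetCard {v : V} {A : Finset V} (hX : P.X v ∈ A) (hY : P.Y v ∈ A) :
    P.e v ∈ A.powersetCard 2 := by
  rw [mem_powersetCard]
  exact ⟨by simp [e, insert_subset_iff, hX, hY], card_pair (P.X_ne_Y v)⟩

lemma card_le_choose {A D : Finset V} (h : ∀ v ∈ D, P.X v ∈ A ∧ P.Y v ∈ A) :
    #D ≤ (#A).choose 2 := by
  rw [← card_powersetCard]
  exact card_le_card_of_injOn P.e (fun v hv ↦ P.e_mem_powersetCard (h v hv).1 (h v hv).2)
    P.e_injective.injOn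

lemma card_T_le_card_F_add (x : V) : #P.T ≤ #(P.F x) + 6 := by
  by_contra! h
  have h7 : 7 ≤ #(P.T \ P.F x) := by
    have := le_card_sdiff (P.F x) P.T
    lia
  obtain ⟨U, hU, hU7⟩ := exists_subset_card_eq h7
  have hw : ∀ c, ∃ w, c ∈ U → w ∉ P.S ∧ P.cls w = c ∧ G.Adj x w := by
    intro c
    by_cases hc : c ∈ U
    · have := mem_sdiff.1 (hU hc)
      have h3 : ¬ P.fiber c ⊆ P.Z x := fun h ↦ this.2 (by simp [F, this.1, h])
      obtain ⟨w, hw, hw'⟩ := not_subset.1 h3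
      rw [mem_fiber] at hw
      rw [mem_Z] at hw'
      exact ⟨w, fun _ ↦ ⟨hw.1, hw.2, by tauto⟩⟩
    · exact ⟨x, fun h ↦ (hc h).elim⟩
  choose r hr using hw
  refine P.starFree ⟨x, U.image r, ?_, ?_, ?_⟩
  · rw [card_image_of_injOn, hU7]
    intro c hc d hd hcd
    rw [← (hr c hc).2.1, ← (hr d hd).2.1, hcd]
  · intro t ht
    obtain ⟨c, hc, rfl⟩ := mem_image.1 ht
    exact (hr c hc).2.2
  · intro t ht t' ht' hne hadj
    obtain ⟨c, hc, rfl⟩ := mem_image.1 ht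
    obtain ⟨d, hd, rfl⟩ := mem_image.1 ht'
    have := P.cls_eq _ _ (hr c hc).1 (hr d hd).1 hadj
    rw [(hr c hc).2.1, (hr d hd).2.1] at this
    exact hne (by rw [this])

lemma F_subset {v : V} (hY : P.Y v ∉ P.S) : P.F (P.X v) ⊆ {P.cls v, P.cls (P.Y v)} := by
  intro c hc
  have hc' := (mem_filter.1 hc)
  obtain ⟨w, hw⟩ := P.fiber_nonempty hc'.1
  rcases P.eq_or_cls_eq hY (hc'.2 hw) with h | h
  · simp [← (P.mem_fiber.1 hw).2, h]
  · simp [← (P.mem_fiber.1 hw).2, h]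

lemma isConcentrated_X {v : V} (hv : v ∈ P.S) (hY : P.Y v ∉ P.S) : P.IsConcentrated (P.X v) := by
  refine ⟨P.cls (P.Y v), fun z hz ↦ (P.eq_or_cls_eq hY hz).resolve_left ?_⟩
  rintro rfl
  exact (P.mem_Z.1 hz).1 hv

lemma card_F_le_one {x : V} (hx : P.IsConcentrated x) : #(P.F x) ≤ 1 := by
  obtain ⟨c, hc⟩ := hx
  rw [← card_singleton c]
  refine card_le_card fun d hd ↦ ?_
  have hd' := mem_filter.1 hd
  obtain ⟨w, hw⟩ := P.fiber_nonempty hd'.1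
  rw [mem_singleton, ← hc w (hd'.2 hw), (P.mem_fiber.1 hw).2]

lemma card_B_le_one {x : V} (hx : ¬ P.IsConcentrated x) (h2 : 2 < #(P.Z x)) : #(P.B x) ≤ 1 := by
  rw [card_le_one]
  intro v hv w hw
  by_contra hne
  rw [mem_B] at hv hw
  obtain ⟨hv, rfl, hvY⟩ := hv
  obtain ⟨hw, hX, hwY⟩ := hw
  have h1 : ∀ z ∈ P.Z (P.X v), z = v ∨ P.cls z = P.cls (P.Y v) := fun z ↦ P.eq_or_cls_eq hvY
  have h1' : ∀ z ∈ P.Z (P.X v), z = w ∨ P.cls z = P.cls (P.Y w) :=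
    fun z hz ↦ P.eq_or_cls_eq hwY (hX ▸ hz)
  have h3 : P.cls v ≠ P.cls (P.Y v) := by
    intro h
    refine hx ⟨P.cls v, fun z hz ↦ ?_⟩
    rcases h1 z hz with rfl | h4
    · rfl
    · rw [h4, h]
  have hwZ : w ∈ P.Z (P.X v) := hX ▸ P.mem_Z_X hw
  have h4 := (h1' v (P.mem_Z_X hv)).resolve_left hne
  have h5 := (h1 w hwZ).resolve_left (Ne.symm hne)
  have : P.Z (P.X v) ⊆ {v, w} := by
    intro z hz
    have := h1 z hz
    have := h1' z hz
    grind
  have := (card_le_card this).trans card_le_two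
  lia

lemma card_compl_S : #{v | v ∉ P.S} + #P.S = Fintype.card V := by
  rw [← card_univ, ← card_filter_add_card_filter_not (s := univ) (· ∈ P.S), add_comm]
  simp

lemma card_T_le (D : Finset κ) (hD : D ⊆ P.T) {W : Finset V}
    (hW : ∀ v ∉ P.S, P.cls v ∈ D → v ∈ W) : #D ≤ #W := by
  refine (card_le_card ?_).trans (card_image_le (f := P.cls))
  intro c hc
  obtain ⟨w, hw⟩ := P.fiber_nonempty (hD hc)
  rw [mem_fiber] at hw
  exact mem_image.2 ⟨w, hW w hw.1 (hw.2 ▸ hc), hw.2⟩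

/-- In a family of large sets indexed by a dense graph, some element lies in two of the
intersections of pairs of sets indexed by edges. -/
lemma _root_.SimpleGraph.false_of_seventeen_edges {σ κ : Type*} [Fintype σ] (H : SimpleGraph σ)
    (hσ : Fintype.card σ = 7) (hH : 17 ≤ #H.edgeFinset) (T : Finset κ) (hT : #T = 10)
    (F : σ → Finset κ) (hFT : ∀ x, F x ⊆ T) (hF : ∀ x, 4 ≤ #(F x))
    (huniq : ∀ c x y x' y', H.Adj x y → H.Adj x' y' → c ∈ F x → c ∈ F y → c ∈ F x' → c ∈ F y' →
      s(x, y) = s(x', y')) : False := by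
  have hdeg : ∑ x, Hᶜ.degree x ≤ 8 := by
    have h1 : ∀ x, Hᶜ.degree x + H.degree x = 6 := by
      intro x
      have := H.degree_lt_card_verts x
      rw [degree_compl]
      lia
    have h2 := sum_congr (rfl : (univ : Finset σ) = univ) fun x _ ↦ h1 x
    rw [sum_add_distrib, H.sum_degrees_eq_twice_card_edges, sum_const, card_univ, hσ] at h2
    simp only [smul_eq_mul] at h2
    lia
  have hbad : #{p : σ × σ | Hᶜ.Adj p.1 p.2} ≤ 8 := by
    have := Hᶜ.two_mul_card_edgeFinset
    rw [sum_degrees_eq_twice_card_edges, this] at hdeg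
    exact hdeg
  let X : κ → Finset σ := fun c ↦ {x | c ∈ F x}
  have hX : ∀ c x, x ∈ X c ↔ c ∈ F x := fun c x ↦ by simp [X]
  have hX3 : ∀ c, #(X c) ≤ 3 := by
    intro c
    obtain ⟨p, hp⟩ : ∃ p : σ × σ, ∀ x ∈ X c, ∀ y ∈ X c, H.Adj x y →
        (x, y) = p ∨ (x, y) = p.swap := by
      by_cases h : ∃ x ∈ X c, ∃ y ∈ X c, H.Adj x y
      · obtain ⟨x, hx, y, hy, hxy⟩ := h
        refine ⟨(x, y), fun x' hx' y' hy' hxy' ↦ ?_⟩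
        have := huniq c x y x' y' hxy hxy' ((hX _ _).1 hx) ((hX _ _).1 hy) ((hX _ _).1 hx')
          ((hX _ _).1 hy')
        rw [Sym2.eq_iff] at this
        grind
      · push Not at h
        have : Nonempty σ := Fintype.card_pos_iff.1 (by lia)
        exact ⟨Classical.arbitrary _, fun x hx y hy hxy ↦ (h x hx y hy hxy).elim⟩
    have hsub : (X c).offDiag ⊆ ({r | Hᶜ.Adj r.1 r.2} : Finset (σ × σ)) ∪ {p, p.swap} := by
      rintro ⟨x, y⟩ hxy
      rw [mem_offDiag] at hxy
      by_cases h : H.Adj x y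
      · have := hp x hxy.1 y hxy.2.1 h
        simp only [mem_union, mem_insert, mem_singleton]
        tauto
      · simp [hxy.2.2, h]
    have h1 := (card_le_card hsub).trans (card_union_le _ _)
    have h2 : #{p, p.swap} ≤ 2 := card_le_two
    rw [offDiag_card] at h1
    by_contra! h
    have h3 : 4 * #(X c) ≤ #(X c) * #(X c) := Nat.mul_le_mul_right _ h
    lia
  let R : Finset κ := {c ∈ T | #(X c) = 3}
  have hR : #(T \ R) ≤ 2 := by
    have h1 : ∑ x, #(F x) = ∑ c ∈ T, #(X c) := by
      have := sum_card_bipartiteAbove_eq_sum_card_bipartiteBelow (s := univ) (t := T)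
        (fun x c ↦ c ∈ F x)
      simp only [bipartiteAbove, bipartiteBelow] at this
      rw [← this]
      exact sum_congr rfl fun x _ ↦ by rw [filter_mem_eq_inter, inter_eq_right.2 (hFT x)]
    have h2 : 28 ≤ ∑ x, #(F x) := by
      have := sum_le_sum fun x (_ : x ∈ univ) ↦ hF x
      rw [sum_const, card_univ, hσ] at this
      simpa using this
    have h3 : ∑ c ∈ T, #(X c) + #(T \ R) ≤ 30 := by
      have h4 : #(T \ R) = ∑ c ∈ T, if #(X c) = 3 then 0 else 1 := by
        rw [← filter_not, card_filter]
        exact sum_congr rfl fun c _ ↦ by split_ifs <;> simp_all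
      rw [h4, ← sum_add_distrib]
      have : ∀ c ∈ T, (#(X c) + if #(X c) = 3 then 0 else 1) ≤ 3 := by
        intro c _
        have := hX3 c
        split_ifs <;> lia
      have := sum_le_card_nsmul _ _ _ this
      rw [hT] at this
      simpa using this
    lia
  have hcherry : ∀ c ∈ R, ∃ q m n, m ≠ n ∧ X c = {q, m, n} ∧ Hᶜ.Adj q m ∧ Hᶜ.Adj q n := by
    intro c hc
    obtain ⟨x, y, z, hxy, hxz, hyz, hc⟩ := card_eq_three.1 (mem_filter.1 hc).2
    have hx : c ∈ F x := (hX c x).1 (by simp [hc])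
    have hy : c ∈ F y := (hX c y).1 (by simp [hc])
    have hz : c ∈ F z := (hX c z).1 (by simp [hc])
    have h1 := huniq c x y x z
    have h2 := huniq c x y y z
    have h3 := huniq c x z y z
    simp only [compl_adj]
    simp only [Sym2.eq_iff] at h1 h2 h3
    by_cases hxy' : H.Adj x y
    · exact ⟨z, x, y, hxy, by grind, by grind, by grind⟩
    by_cases hxz' : H.Adj x z
    · exact ⟨y, x, z, hxz, by grind, by grind [H.adj_comm], by grind⟩
    · exact ⟨x, y, z, hyz, by grind, by grind, by grind⟩
  have hone : ∀ x, 1 ≤ Hᶜ.degree x := by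
    intro x
    obtain ⟨c, hcF, hc⟩ : ∃ c ∈ F x, c ∉ T \ R :=
      exists_mem_notMem_of_card_lt_card (by have := hF x; lia)
    have hcR : c ∈ R := by
      have := hFT x hcF
      simp only [mem_sdiff, not_and, not_not] at hc
      exact hc this
    obtain ⟨q, m, n, -, hXc, hm, hn⟩ := hcherry c hcR
    have hx : x ∈ X c := (hX c x).2 hcF
    rw [Nat.one_le_iff_ne_zero, ← Nat.pos_iff_ne_zero, degree_pos_iff_exists_adj]
    simp only [hXc, mem_insert, mem_singleton] at hx
    rcases hx with rfl | rfl | rfl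
    exacts [⟨_, hm⟩, ⟨_, hm.symm⟩, ⟨_, hn.symm⟩]
  have hsum : ∀ D : Finset σ, ∑ x ∈ D, (Hᶜ.degree x - 1) ≤ 1 := by
    intro D
    have h1 : ∑ x, (Hᶜ.degree x - 1) + 7 ≤ 8 := by
      have : ∑ x : σ, 1 = 7 := by simp [hσ]
      rw [← this, ← sum_add_distrib]
      refine le_trans (sum_le_sum fun x _ ↦ ?_) hdeg
      have := hone x
      lia
    have := sum_le_sum_of_subset (f := fun x ↦ Hᶜ.degree x - 1) (subset_univ D)
    lia
  have hRpos : ∃ c, c ∈ R := by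
    by_contra! h
    rw [← eq_empty_iff_forall_notMem] at h
    simp [h, hT] at hR
  have hnbr : ∀ q m n, m ≠ n → Hᶜ.Adj q m → Hᶜ.Adj q n →
      2 ≤ Hᶜ.degree q ∧ Hᶜ.neighborFinset q = {m, n} := by
    intro q m n hmn hm hn
    have hsub : {m, n} ⊆ Hᶜ.neighborFinset q := by
      simp [insert_subset_iff, -compl_adj, hm, hn]
    have h1 := card_le_card hsub
    have h2 := hsum {q}
    rw [sum_singleton] at h2
    rw [card_pair hmn, card_neighborFinset_eq_degree] at h1
    refine ⟨h1, (eq_of_subset_of_card_le hsub ?_).symm⟩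
    rw [card_pair hmn, card_neighborFinset_eq_degree]
    lia
  obtain ⟨c, hc⟩ := hRpos
  have hsame : ∀ d ∈ R, X d = X c := by
    intro d hd
    obtain ⟨q, m, n, hmn, hXc, hm, hn⟩ := hcherry c hc
    obtain ⟨q', m', n', hmn', hXd, hm', hn'⟩ := hcherry d hd
    have h1 := hnbr q m n hmn hm hn
    have h2 := hnbr q' m' n' hmn' hm' hn'
    have : q = q' := by
      by_contra hne
      have := hsum {q, q'}
      rw [sum_pair hne] at this
      lia
    subst this
    rw [hXc, hXd, ← h1.2, ← h2.2]
  obtain ⟨x, -, hx⟩ : ∃ x ∈ univ, x ∉ X c :=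
    exists_mem_notMem_of_card_lt_card (by rw [card_univ]; have := hX3 c; lia)
  have : F x ⊆ T \ R := by
    intro d hd
    refine mem_sdiff.2 ⟨hFT x hd, fun hdR ↦ hx ?_⟩
    rw [← hsame d hdR]
    exact (hX d x).2 hd
  have := card_le_card this
  have := hF x
  lia

lemma F_subset_T (x : V) : P.F x ⊆ P.T := filter_subset _ _

/-- The pairs of barrier vertices that dominate all but one vertex. -/
def pairGraph : SimpleGraph P.S where
  Adj x y := x ≠ y ∧ ∃ v, P.e v = {x.1, y.1}
  symm := ⟨fun x y ⟨hne, v, hv⟩ ↦ ⟨hne.symm, v, by rw [hv, pair_comm]⟩⟩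
  loopless := ⟨fun _ h ↦ h.1 rfl⟩

variable {P}

lemma card_le_card_edgeFinset_pairGraph (hY : ∀ v, P.Y v ∈ P.S) :
    Fintype.card V ≤ #P.pairGraph.edgeFinset := by
  rw [← card_univ]
  refine card_le_card_of_injOn
    (fun v ↦ s((⟨P.X v, P.X_mem v⟩ : P.S), (⟨P.Y v, hY v⟩ : P.S))) (fun v _ ↦ ?_) ?_
  · rw [mem_coe, mem_edgeFinset, mem_edgeSet]
    exact ⟨fun h ↦ P.X_ne_Y v (congrArg Subtype.val h), v, rfl⟩
  · intro v _ w _ h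
    refine P.e_injective ?_
    simp only [Sym2.eq_iff, Subtype.mk.injEq] at h
    unfold e
    rcases h with ⟨h1, h2⟩ | ⟨h1, h2⟩
    · rw [h1, h2]
    · rw [h1, h2, pair_comm]

lemma fiber_eq_of_mem_F {v x y : V} {c : κ} (hY : P.Y v ∈ P.S) (he : P.e v = {x, y})
    (hx : c ∈ P.F x) (hy : c ∈ P.F y) : P.fiber c = {v} := by
  have hx' := mem_filter.1 hx
  have hy' := mem_filter.1 hy
  exact (P.fiber_nonempty hx'.1).subset_singleton_iff.1 fun z hz ↦
    mem_singleton.2 (P.eq_of_mem_Z_of_e_eq hY he (hx'.2 hz) (hy'.2 hz))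

lemma card_F_inter_le_one {v x y : V} (hY : P.Y v ∈ P.S) (he : P.e v = {x, y}) :
    #(P.F x ∩ P.F y) ≤ 1 := by
  rw [← card_singleton (P.cls v)]
  refine card_le_card fun c hc ↦ ?_
  rw [mem_inter] at hc
  have h := fiber_eq_of_mem_F hY he hc.1 hc.2
  have : v ∈ P.fiber c := by simp [h]
  rw [mem_singleton, (P.mem_fiber.1 this).2]

lemma card_T_le_ten_of_triangle (hY : ∀ v, P.Y v ∈ P.S) {x y z : P.S} (hxy : P.pairGraph.Adj x y)
    (hxz : P.pairGraph.Adj x z) (hyz : P.pairGraph.Adj y z) : #P.T ≤ 10 := by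
  obtain ⟨-, u, hu⟩ := hxy
  obtain ⟨-, v, hv⟩ := hxz
  obtain ⟨-, w, hw⟩ := hyz
  have h1 := card_F_inter_le_one (hY u) hu
  have h2 := card_F_inter_le_one (hY v) hv
  have h3 := card_F_inter_le_one (hY w) hw
  have h4 := card_union_add_card_inter (P.F x) (P.F y)
  have h5 := card_union_add_card_inter (P.F x ∪ P.F y) (P.F z)
  have h6 : #((P.F x ∪ P.F y) ∩ P.F z) ≤ #(P.F x ∩ P.F z) + #(P.F y ∩ P.F z) := by
    rw [union_inter_distrib_right]
    exact card_union_le _ _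
  have h7 : #(P.F x ∪ P.F y ∪ P.F z) ≤ #P.T :=
    card_le_card (union_subset (union_subset (P.F_subset_T _) (P.F_subset_T _)) (P.F_subset_T _))
  have := P.card_T_le_card_F_add x
  have := P.card_T_le_card_F_add y
  have := P.card_T_le_card_F_add z
  lia

lemma card_S_add_card_T_le : #P.S + #P.T ≤ Fintype.card V := by
  have := P.card_T_le P.T subset_rfl (W := {v | v ∉ P.S}) (by simp +contextual)
  have := P.card_compl_S
  lia

lemma card_eq_fifteen (hS : 6 ≤ #P.S) : Fintype.card V = 15 := by
  have hT := P.card_T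
  have hVS := P.card_S_add_card_T_le
  have hY : ∀ v, P.Y v ∈ P.S := by
    intro v
    by_contra hY
    have h1 := (card_le_card (P.F_subset hY)).trans card_le_two
    have h2 := P.card_T_le_card_F_add (P.X v)
    lia
  have hS9 : #P.S ≤ 9 := by
    obtain ⟨v, hv⟩ : P.S.Nonempty := card_pos.1 (by lia)
    have h1 : Disjoint (P.F (P.X v)) (P.F (P.Y v)) := by
      rw [Finset.disjoint_left]
      intro c hx hy
      have h := fiber_eq_of_mem_F (hY v) rfl hx hy
      have : v ∈ P.fiber c := by simp [h]
      exact (P.mem_fiber.1 this).1 hv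
    have h2 := card_union_of_disjoint h1
    have h3 := card_le_card (union_subset (P.F_subset_T (P.X v)) (P.F_subset_T (P.Y v)))
    have := P.card_T_le_card_F_add (P.X v)
    have := P.card_T_le_card_F_add (P.Y v)
    lia
  have hE := card_le_card_edgeFinset_pairGraph hY
  have hcard : Fintype.card P.S = #P.S := Fintype.card_coe _
  have hchoose : #P.pairGraph.edgeFinset ≤ (#P.S).choose 2 :=
    hcard ▸ card_edgeFinset_le_card_choose_two
  by_cases h7 : #P.S ≤ 7
  · have : #P.S = 6 ∨ #P.S = 7 := by lia
    rcases this with h | h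
    · rw [h] at hchoose
      have : Nat.choose 6 2 = 15 := rfl
      lia
    · refine (P.pairGraph.false_of_seventeen_edges (hcard.trans h) (by lia) P.T (by lia)
        (fun x ↦ P.F x) (fun x ↦ P.F_subset_T x)
        (fun x ↦ by have := P.card_T_le_card_F_add x; lia) ?_).elim
      rintro c x y x' y' ⟨-, v, hv⟩ ⟨-, w, hw⟩ hx hy hx' hy'
      have h1 := fiber_eq_of_mem_F (hY v) hv hx hy
      have h2 := fiber_eq_of_mem_F (hY w) hw hx' hy'
      rw [h1, singleton_inj] at h2
      subst h2
      rw [hv] at hw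
      have h3 : ({x.1, y.1} : Set V) = {x'.1, y'.1} := by
        rw [← coe_pair, ← coe_pair, hw]
      rw [Set.pair_eq_pair_iff] at h3
      rw [Sym2.eq_iff]
      exact h3.imp (fun h ↦ ⟨Subtype.ext h.1, Subtype.ext h.2⟩)
        fun h ↦ ⟨Subtype.ext h.1, Subtype.ext h.2⟩
  · exfalso
    have hfree : P.pairGraph.CliqueFree 3 := by
      intro A hA
      rw [is3Clique_iff] at hA
      obtain ⟨x, y, z, hxy, hxz, hyz, -⟩ := hA
      have := P.card_T_le_ten_of_triangle hY hxy hxz hyz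
      lia
    have h1 := hfree.card_edgeFinset_le (r := 2)
    simp only [hcard] at h1
    have : #P.S = 8 ∨ #P.S = 9 := by lia
    rcases this with h | h
    · rw [h] at h1
      norm_num at h1
      lia
    · rw [h] at h1
      norm_num at h1
      lia

variable (P)

/-- The barrier vertices whose nonneighbours outside the barrier lie in a single class. -/
def conc : Finset V := {x ∈ P.S | P.IsConcentrated x}

/-- The other barrier vertices with at most two nonneighbours outside the barrier. -/
def small : Finset V := {x ∈ P.S | ¬ P.IsConcentrated x ∧ #(P.Z x) ≤ 2}

/-- The other barrier vertices with more than two nonneighbours outside the barrier. -/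
def large : Finset V := {x ∈ P.S | ¬ P.IsConcentrated x ∧ 2 < #(P.Z x)}

variable {P}

lemma mem_conc {x : V} : x ∈ P.conc ↔ x ∈ P.S ∧ P.IsConcentrated x := by simp [conc]

lemma mem_small {x : V} : x ∈ P.small ↔ x ∈ P.S ∧ ¬ P.IsConcentrated x ∧ #(P.Z x) ≤ 2 := by
  simp [small]

lemma mem_large {x : V} : x ∈ P.large ↔ x ∈ P.S ∧ ¬ P.IsConcentrated x ∧ 2 < #(P.Z x) := by
  simp [large]

lemma mem_small_or_mem_large {x : V} (hx : x ∈ P.S) (hx' : x ∉ P.conc) :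
    x ∈ P.small ∨ x ∈ P.large := by
  rw [mem_conc] at hx'
  rw [mem_small, mem_large]
  have := le_or_gt #(P.Z x) 2
  tauto

lemma card_conc_add_card_small_add_card_large : #P.conc + #P.small + #P.large = #P.S := by
  have h1 := card_filter_add_card_filter_not (s := P.S) P.IsConcentrated
  have h2 := card_filter_add_card_filter_not (s := P.S.filter (¬ P.IsConcentrated ·))
    (fun x ↦ #(P.Z x) ≤ 2)
  simp only [filter_filter, not_le] at h2
  simp only [conc, small, large]
  lia

lemma sum_card_Z_inter_le (W : Finset V) : ∑ x ∈ P.small, #(P.Z x ∩ W) ≤ 2 * #P.small := by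
  rw [mul_comm]
  exact sum_le_card_nsmul _ _ _ fun x hx ↦
    (card_le_card inter_subset_left).trans (mem_small.1 hx).2.2

lemma card_le_sum_small_add {W : Finset V} (hW : ∀ v ∈ W, v ∉ P.S)
    (hX : ∀ v ∈ W, P.X v ∉ P.conc) (hY : ∀ v ∈ W, P.Y v ∉ P.conc) :
    #W ≤ ∑ x ∈ P.small, #(P.Z x ∩ W) + #{x ∈ P.large | (P.B x).Nonempty} +
      #{v ∈ W | P.X v ∈ P.large ∧ P.Y v ∈ P.large} := by
  have hsub : W ⊆ P.small.biUnion (fun x ↦ P.Z x ∩ W) ∪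
      ({x ∈ P.large | (P.B x).Nonempty} : Finset V).biUnion P.B ∪
      {v ∈ W | P.X v ∈ P.large ∧ P.Y v ∈ P.large} := by
    intro v hv
    simp only [mem_union, mem_biUnion, mem_inter, mem_filter]
    rcases mem_small_or_mem_large (P.X_mem v) (hX v hv) with h | h
    · exact .inl <| .inl ⟨_, h, P.mem_Z_X (hW v hv), hv⟩
    by_cases hYS : P.Y v ∈ P.S
    · rcases mem_small_or_mem_large hYS (hY v hv) with h' | h'
      · exact .inl <| .inl ⟨_, h', P.mem_Z_Y (hW v hv), hv⟩
      · exact .inr ⟨hv, h, h'⟩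
    · have : v ∈ P.B (P.X v) := P.mem_B.2 ⟨hW v hv, rfl, hYS⟩
      exact .inl <| .inr ⟨_, ⟨h, v, this⟩, this⟩
  refine (card_le_card hsub).trans ((card_union_le _ _).trans (Nat.add_le_add_right ?_ _))
  refine (card_union_le _ _).trans (add_le_add card_biUnion_le ?_)
  refine (card_biUnion_le_card_mul _ _ 1 fun x hx ↦ ?_).trans (mul_one _).le
  have := mem_large.1 (mem_filter.1 hx).1
  exact P.card_B_le_one this.2.1 this.2.2

lemma exists_uncovered : ∃ (C : V → κ) (W : Finset V),
    (∀ x ∈ P.conc, ∀ z ∈ P.Z x, P.cls z = C x) ∧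
    (∀ v, v ∈ W ↔ v ∉ P.S ∧ ∀ x ∈ P.conc, P.cls v ≠ C x) ∧ #P.T ≤ #W + #P.conc := by
  have : ∀ x, ∃ c, x ∈ P.conc → ∀ z ∈ P.Z x, P.cls z = c := by
    intro x
    by_cases hx : x ∈ P.conc
    · obtain ⟨c, hc⟩ := (mem_conc.1 hx).2
      exact ⟨c, fun _ ↦ hc⟩
    · exact ⟨P.cls x, fun h ↦ (hx h).elim⟩
  choose C hC using this
  refine ⟨C, univ.filter fun v ↦ v ∉ P.S ∧ ∀ x ∈ P.conc, P.cls v ≠ C x, hC, by simp, ?_⟩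
  have h1 := P.card_T_le (P.T \ P.conc.image C) sdiff_subset
    (W := {v | v ∉ P.S ∧ ∀ x ∈ P.conc, P.cls v ≠ C x}) (by
      intro v hv hv'
      simp only [mem_sdiff, mem_image, not_exists, not_and] at hv'
      simp only [mem_filter, mem_univ, true_and]
      exact ⟨hv, fun x hx ↦ Ne.symm (hv'.2 x hx)⟩)
  have h2 := le_card_sdiff (P.conc.image C) P.T
  have h3 : #(P.conc.image C) ≤ #P.conc := card_image_le
  lia

lemma false_of_card_S_eq_four_of_adj {u v x y : V} (hS : P.S = {u, v, x, y}) (h4 : #P.S = 4)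
    (hY : ∀ w ∈ P.S, P.Y w ∈ P.S) (he : P.e v = {x, y}) (hux : G.Adj u x) : False := by
  have hd : #({u, v, x, y} : Finset V) = 4 := hS ▸ h4
  have key : ∀ w ∈ P.S, ∃ a ∈ P.S, ∃ b ∈ P.S, a ≠ b ∧ a ≠ w ∧ b ≠ w ∧ ¬ G.Adj a w ∧ ¬ G.Adj b w ∧
      ∀ w', w' ≠ w → w' = a ∨ w' = b ∨ G.Adj a w' ∨ G.Adj b w' := fun w hw ↦
    ⟨P.X w, P.X_mem w, P.Y w, hY w hw, P.X_ne_Y w, P.X_ne w, P.Y_ne w, P.not_adj_X w,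
      P.not_adj_Y w, P.dominates w⟩
  have hxv : ¬ G.Adj x v := by
    have : x ∈ P.e v := by simp [he]
    rw [e, mem_insert, mem_singleton] at this
    rcases this with h | h
    exacts [h ▸ P.not_adj_X v, h ▸ P.not_adj_Y v]
  have hne : x ≠ u ∧ x ≠ v ∧ x ≠ y ∧ u ≠ y := by
    refine ⟨?_, ?_, ?_, ?_⟩ <;> rintro rfl <;> grind
  obtain ⟨a, ha, b, hb, hab, hau, hbu, hau', hbu', hdom⟩ := key u (by simp [hS])
  have hyx : G.Adj y x := by
    have := hdom x hne.1
    simp only [hS, mem_insert, mem_singleton] at ha hb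
    grind [G.adj_comm]
  obtain ⟨a', ha', b', hb', hab', hax', hbx', hax, hbx, -⟩ := key x (by simp [hS])
  simp only [hS, mem_insert, mem_singleton] at ha' hb'
  grind

lemma exists_Y_notMem (h4 : #P.S = 4) : ∃ v ∈ P.S, P.Y v ∉ P.S := by
  by_contra! hY
  obtain ⟨v, hv⟩ : P.S.Nonempty := card_pos.1 (by lia)
  have hsub : {v, P.X v, P.Y v} ⊆ P.S := by
    simp [insert_subset_iff, hv, P.X_mem v, hY v hv]
  have h3 : #{v, P.X v, P.Y v} = 3 :=
    card_eq_three.2 ⟨_, _, _, (P.X_ne v).symm, (P.Y_ne v).symm, P.X_ne_Y v, rfl⟩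
  obtain ⟨u, hu, hu'⟩ := exists_mem_notMem_of_card_lt_card (s := {v, P.X v, P.Y v}) (t := P.S)
    (by lia)
  have hS : {u, v, P.X v, P.Y v} = P.S :=
    eq_of_subset_of_card_le (insert_subset hu hsub) (by rw [card_insert_of_notMem hu']; lia)
  simp only [mem_insert, mem_singleton, not_or] at hu'
  rcases P.dominates v u hu'.1 with h | h | h | h
  · exact hu'.2.1 h
  · exact hu'.2.2 h
  · exact false_of_card_S_eq_four_of_adj hS.symm h4 hY rfl h.symm
  · refine false_of_card_S_eq_four_of_adj (x := P.Y v) (y := P.X v) (u := u) (v := v) ?_ h4 hY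
      (pair_comm _ _) h.symm
    rw [← hS, pair_comm (P.X v)]

lemma card_eq_nine (hS : P.S.Nonempty) (h4 : #P.S ≤ 4) : Fintype.card V = 9 := by
  have hT := P.card_T
  have hN := P.card_conc_add_card_small_add_card_large
  have hS0 := card_pos.2 hS
  obtain ⟨C, W, hC, hW, hTW⟩ := P.exists_uncovered
  have hX : ∀ v ∈ W, P.X v ∉ P.conc := fun v hv h ↦
    ((hW v).1 hv).2 _ h (hC _ h _ (P.mem_Z_X ((hW v).1 hv).1))
  have hY : ∀ v ∈ W, P.Y v ∉ P.conc := fun v hv h ↦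
    ((hW v).1 hv).2 _ h (hC _ h _ (P.mem_Z_Y ((hW v).1 hv).1))
  have hle := card_le_sum_small_add (fun v hv ↦ ((hW v).1 hv).1) hX hY
  have hsum := P.sum_card_Z_inter_le W
  have hL : #{x ∈ P.large | (P.B x).Nonempty} ≤ #P.large := card_filter_le _ _
  set A : Finset V := {v ∈ W | P.X v ∈ P.large ∧ P.Y v ∈ P.large} with hA
  have hAc : #A ≤ (#P.large).choose 2 := P.card_le_choose fun v hv ↦ (mem_filter.1 hv).2
  have hl : #P.large = 0 ∨ #P.large = 1 ∨ #P.large = 2 ∨ #P.large = 3 ∨ #P.large = 4 := by lia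
  have h02 : Nat.choose 0 2 = 0 := rfl
  have h12 : Nat.choose 1 2 = 0 := rfl
  have h22 : Nat.choose 2 2 = 1 := rfl
  have h32 : Nat.choose 3 2 = 3 := rfl
  by_cases hS4 : #P.S = 4
  · exfalso
    obtain ⟨v, hv, hYv⟩ := P.exists_Y_notMem hS4
    have hx : P.X v ∈ P.conc := mem_conc.2 ⟨P.X_mem v, P.isConcentrated_X hv hYv⟩
    have hc1 : #P.conc = 1 := by
      have := card_pos.2 ⟨_, hx⟩
      rcases hl with h | h | h | h | h <;> rw [h] at hAc <;> lia
    have hconc : ∀ x ∈ P.conc, x = P.X v := fun x hx' ↦ card_le_one.1 hc1.le _ hx' _ hx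
    have hclass : P.cls (P.Y v) = C (P.X v) := by
      obtain ⟨c, hc⟩ : (P.F (P.X v)).Nonempty :=
        card_pos.1 (by have := P.card_T_le_card_F_add (P.X v); lia)
      obtain ⟨z, hz⟩ := P.fiber_nonempty (P.F_subset_T _ hc)
      have hz' := (mem_filter.1 hc).2 hz
      rw [← hC _ hx z hz']
      refine ((P.eq_or_cls_eq hYv hz').resolve_left ?_).symm
      rintro rfl
      exact (P.mem_fiber.1 hz).1 hv
    have hYW : P.Y v ∉ W := fun h ↦ ((hW _).1 h).2 _ hx hclass
    have hvc : v ∉ P.conc := fun h ↦ P.X_ne v (hconc v h).symm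
    have hlt : v ∈ P.small → ∑ x ∈ P.small, #(P.Z x ∩ W) < 2 * #P.small := by
      intro hvs
      rw [mul_comm, ← smul_eq_mul, ← sum_const]
      refine sum_lt_sum (fun x hx ↦ (card_le_card inter_subset_left).trans (mem_small.1 hx).2.2)
        ⟨v, hvs, lt_of_lt_of_le (card_lt_card ?_) (mem_small.1 hvs).2.2⟩
      refine Finset.ssubset_iff_subset_ne.2 ⟨inter_subset_left, fun h ↦ hYW ?_⟩
      rw [inter_eq_left] at h
      exact h (P.mem_Z.2 ⟨hYv, fun h ↦ P.not_adj_Y v h.symm⟩)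
    have hA2 : #P.large = 3 → #A ≤ 2 := by
      intro h3
      have hs : P.small = ∅ := card_eq_zero.1 (by lia)
      have hmem : ∀ x ∈ P.S, x ≠ P.X v → x ∈ P.large := fun x hx hne ↦
        (mem_small_or_mem_large hx fun h ↦ hne (hconc x h)).resolve_left (by simp [hs])
      have hXX : P.X (P.X v) ∈ P.large := hmem _ (P.X_mem _) (P.X_ne _)
      have hYX : P.Y (P.X v) ∈ P.large := by
        refine hmem _ ?_ (P.Y_ne _)
        by_contra hn
        exact (mem_large.1 hXX).2.1 (P.isConcentrated_X (P.X_mem v) hn)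
      have h1 : #(insert (P.X v) A) ≤ (#P.large).choose 2 := P.card_le_choose fun w hw ↦ by
        rcases mem_insert.1 hw with rfl | hw
        exacts [⟨hXX, hYX⟩, (mem_filter.1 hw).2]
      rw [card_insert_of_notMem, h3] at h1
      · lia
      · intro h
        exact ((hW _).1 (mem_filter.1 h).1).1 (P.X_mem v)
    rcases mem_small_or_mem_large hv hvc with h' | h'
    · have := hlt h'
      have := card_pos.2 ⟨_, h'⟩
      rcases hl with h | h | h | h | h <;> rw [h] at hAc <;> lia
    · have := card_pos.2 ⟨_, h'⟩
      rcases hl with h | h | h | h | h <;> rw [h] at hAc <;> lia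
  · have hc0 : #P.conc = 0 ∧ #P.S = 3 ∧ #W ≤ 6 := by
      rcases hl with h | h | h | h | h <;> rw [h] at hAc <;> lia
    have hWO : W = ({v | v ∉ P.S} : Finset V) := by
      ext v
      simp [hW, card_eq_zero.1 hc0.1]
    have h1 := P.card_compl_S
    have h2 := P.card_S_add_card_T_le
    rw [← hWO] at h1
    lia

lemma fiber_cls_eq_singleton {v : V} (hv : v ∉ P.S) (hY : P.Y v ∉ P.S)
    (hF : 2 ≤ #(P.F (P.X v))) :
    P.fiber (P.cls v) = {v} ∧ P.fiber (P.cls (P.Y v)) ⊆ P.Z (P.X v) := by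
  have hsub := P.F_subset hY
  have hne : P.cls v ≠ P.cls (P.Y v) := by
    intro h
    rw [← h, pair_eq_singleton] at hsub
    have := card_le_card hsub
    rw [card_singleton] at this
    lia
  have heq := eq_of_subset_of_card_le hsub (by rw [card_pair hne]; exact hF)
  have h1 : P.cls v ∈ P.F (P.X v) := by simp [heq]
  have h2 : P.cls (P.Y v) ∈ P.F (P.X v) := by simp [heq]
  refine ⟨?_, (mem_filter.1 h2).2⟩
  refine subset_antisymm (fun z hz ↦ ?_) (by simp [P.mem_fiber, hv])
  have := P.eq_or_cls_eq hY ((mem_filter.1 h1).2 hz)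
  rw [(P.mem_fiber.1 hz).2] at this
  simpa [hne] using this

lemma card_eq_thirteen (h5 : #P.S = 5) : Fintype.card V = 13 := by
  have hT := P.card_T
  have hF : ∀ x, 2 ≤ #(P.F x) := fun x ↦ by have := P.card_T_le_card_F_add x; lia
  have hnc : ∀ x, ¬ P.IsConcentrated x := fun x h ↦ by
    have := P.card_F_le_one h
    have := hF x
    lia
  have hYS : ∀ v ∈ P.S, P.Y v ∈ P.S := fun v hv ↦ by
    by_contra h
    exact hnc _ (P.isConcentrated_X hv h)
  have hconc : P.conc = ∅ := by simp [conc, hnc]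
  have hN := P.card_conc_add_card_small_add_card_large
  rw [hconc, card_empty] at hN
  by_contra h13
  have hO : #P.T * 1 < #({v | v ∉ P.S} : Finset V) := by
    have := P.card_S_add_card_T_le
    have := P.card_compl_S
    lia
  obtain ⟨c₀, hc₀, hfib⟩ := exists_lt_card_fiber_of_mul_lt_card_of_maps_to
    (f := P.cls) (t := P.T) (fun v hv ↦ P.cls_mem v (by simpa using hv)) hO
  rw [filter_filter] at hfib
  change 1 < #(P.fiber c₀) at hfib
  have hthree : ∀ c ∈ P.T, 1 < #(P.fiber c) → 3 ≤ #(P.fiber c) := by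
    intro c hc h
    obtain ⟨k, hk⟩ : Odd #(P.fiber c) := P.odd_class c hc
    lia
  have h₀ := hthree c₀ hc₀ hfib
  have hYfib : ∀ v ∉ P.S, 1 < #(P.fiber (P.cls v)) → P.Y v ∈ P.S := by
    intro v hv h
    by_contra hY
    rw [(fiber_cls_eq_singleton hv hY (hF _)).1, card_singleton] at h
    lia
  have hfive : ∀ D : Finset V, (∀ v ∈ D, v ∉ P.S ∧ P.Y v ∈ P.S) → #D ≤ 5 := by
    intro D hD
    have hdisj : Disjoint P.S D := Finset.disjoint_right.2 fun v hv ↦ (hD v hv).1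
    have h1 : #(P.S ∪ D) ≤ (#P.S).choose 2 := P.card_le_choose fun v hv ↦
      ⟨P.X_mem v, (mem_union.1 hv).elim (hYS v) fun h ↦ (hD v h).2⟩
    rw [card_union_of_disjoint hdisj, h5] at h1
    have : Nat.choose 5 2 = 10 := rfl
    lia
  have hC₀ : ∀ v ∈ P.fiber c₀, v ∉ P.S ∧ P.cls v = c₀ ∧ P.Y v ∈ P.S := fun v hv ↦ by
    have h1 := P.mem_fiber.1 hv
    exact ⟨h1.1, h1.2, hYfib v h1.1 (h1.2 ▸ hfib)⟩
  have huniq : ∀ c ∈ P.T, 1 < #(P.fiber c) → c = c₀ := by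
    intro c hc h
    by_contra hne
    have hdisj : Disjoint (P.fiber c₀) (P.fiber c) := Finset.disjoint_left.2 fun v hv hv' ↦
      hne ((P.mem_fiber.1 hv').2.symm.trans (P.mem_fiber.1 hv).2)
    have h1 := hfive (P.fiber c₀ ∪ P.fiber c) (by
      intro v hv
      rcases mem_union.1 hv with hv | hv
      · exact ⟨(hC₀ v hv).1, (hC₀ v hv).2.2⟩
      · have h1 := P.mem_fiber.1 hv
        exact ⟨h1.1, hYfib v h1.1 (h1.2 ▸ h)⟩)
    rw [card_union_of_disjoint hdisj] at h1
    have := hthree c hc h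
    lia
  have hmem_large : ∀ x ∈ P.S, ∀ v ∈ P.fiber c₀, v ∈ P.Z x → x ∈ P.large := by
    intro x hx v hv hvx
    refine mem_large.2 ⟨hx, hnc x, ?_⟩
    by_cases hcF : c₀ ∈ P.F x
    · have := card_le_card (mem_filter.1 hcF).2
      lia
    · have hsub : insert c₀ (P.F x) ⊆ (P.Z x).image P.cls := by
        refine insert_subset (mem_image.2 ⟨v, hvx, (hC₀ v hv).2.1⟩) fun c hc ↦ ?_
        obtain ⟨z, hz⟩ := P.fiber_nonempty (P.F_subset_T _ hc)
        exact mem_image.2 ⟨z, (mem_filter.1 hc).2 hz, (P.mem_fiber.1 hz).2⟩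
      have h1 := (card_le_card hsub).trans card_image_le
      rw [card_insert_of_notMem hcF] at h1
      have := hF x
      lia
  set W : Finset V := {v | v ∉ P.S ∧ P.cls v ≠ c₀} with hWdef
  have hW : ∀ v, v ∈ W ↔ v ∉ P.S ∧ P.cls v ≠ c₀ := by simp [hWdef]
  have hW7 : 7 ≤ #W := by
    have := P.card_T_le (P.T.erase c₀) (erase_subset _ _) (W := W) fun v hv hv' ↦
      (hW v).2 ⟨hv, (mem_erase.1 hv').1⟩
    rw [card_erase_of_mem hc₀] at this
    lia
  have hle := card_le_sum_small_add (W := W) (fun v hv ↦ ((hW v).1 hv).1) (by simp [hconc])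
    (by simp [hconc])
  have hsum := P.sum_card_Z_inter_le W
  set A : Finset V := {v ∈ W | P.X v ∈ P.large ∧ P.Y v ∈ P.large} with hA
  have hdisjA : Disjoint (P.fiber c₀) A := Finset.disjoint_left.2 fun v hv hv' ↦
    ((hW v).1 (mem_filter.1 hv').1).2 (hC₀ v hv).2.1
  have hA1 : #(P.fiber c₀ ∪ A) ≤ (#P.large).choose 2 := P.card_le_choose fun v hv ↦ by
    rcases mem_union.1 hv with hv' | hv'
    · have := hC₀ v hv'
      exact ⟨hmem_large _ (P.X_mem v) v hv' (P.mem_Z_X this.1),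
        hmem_large _ this.2.2 v hv' (P.mem_Z_Y this.1)⟩
    · exact (mem_filter.1 hv').2
  have hA2 := hfive (P.fiber c₀ ∪ A) fun v hv ↦ by
    rcases mem_union.1 hv with hv' | hv'
    · exact ⟨(hC₀ v hv').1, (hC₀ v hv').2.2⟩
    · have := mem_filter.1 hv'
      exact ⟨((hW v).1 this.1).1, (mem_large.1 this.2.2).1⟩
  rw [card_union_of_disjoint hdisjA] at hA1 hA2
  set L : Finset V := {x ∈ P.large | (P.B x).Nonempty} with hL
  have hLZ : ∀ x ∈ L, P.fiber c₀ ⊆ P.Z x := by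
    intro x hx
    obtain ⟨hx, v, hv⟩ := mem_filter.1 hx
    obtain ⟨hvS, rfl, hY⟩ := P.mem_B.1 hv
    have h1 := (fiber_cls_eq_singleton hvS hY (hF _)).2
    have h2 : P.Z (P.X v) ⊆ insert v (P.fiber (P.cls (P.Y v))) := fun z hz ↦
      mem_insert.2 <| (P.eq_or_cls_eq hY hz).imp id fun h ↦ P.mem_fiber.2 ⟨(P.mem_Z.1 hz).1, h⟩
    have h3 := (card_le_card h2).trans (card_insert_le _ _)
    have h4 := (mem_large.1 hx).2.2
    exact huniq _ (P.cls_mem _ hY) (by lia) ▸ h1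
  have hL2 : (#L).choose 2 ≤ 2 := by
    have hdisj : Disjoint P.S (P.fiber c₀) := Finset.disjoint_right.2 fun v hv ↦ (hC₀ v hv).1
    have hY : ∀ v ∈ P.S ∪ P.fiber c₀, P.Y v ∈ P.S := fun v hv ↦
      (mem_union.1 hv).elim (hYS v) fun h ↦ (hC₀ v h).2.2
    have hdisj' : Disjoint ((P.S ∪ P.fiber c₀).image P.e) (L.powersetCard 2) := by
      refine Finset.disjoint_left.2 fun p hp hp' ↦ ?_
      obtain ⟨v, hv, rfl⟩ := mem_image.1 hp
      have hsub := (mem_powersetCard.1 hp').1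
      rw [e, insert_subset_iff, singleton_subset_iff] at hsub
      have : P.fiber c₀ ⊆ {v} := fun z hz ↦
        mem_singleton.2 (P.eq_of_mem_Z (hY v hv) (hLZ _ hsub.1 hz) (hLZ _ hsub.2 hz))
      have := card_le_card this
      rw [card_singleton] at this
      lia
    have hsub : (P.S ∪ P.fiber c₀).image P.e ∪ L.powersetCard 2 ⊆ P.S.powersetCard 2 := by
      refine union_subset (fun p hp ↦ ?_) (powersetCard_mono fun x hx ↦ ?_)
      · obtain ⟨v, hv, rfl⟩ := mem_image.1 hp
        exact P.e_mem_powersetCard (P.X_mem v) (hY v hv)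
      · exact (mem_large.1 (mem_filter.1 hx).1).1
    have h1 := card_le_card hsub
    rw [card_union_of_disjoint hdisj', card_image_of_injective _ P.e_injective,
      card_union_of_disjoint hdisj, card_powersetCard, card_powersetCard, h5] at h1
    have : Nat.choose 5 2 = 10 := rfl
    lia
  have hL2' : #L ≤ 2 := by
    by_contra! h
    have : Nat.choose 3 2 ≤ (#L).choose 2 := Nat.choose_le_choose 2 h
    have : Nat.choose 3 2 = 3 := rfl
    lia
  have h02 : Nat.choose 0 2 = 0 := rfl
  have h12 : Nat.choose 1 2 = 0 := rfl
  have h22 : Nat.choose 2 2 = 1 := rfl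
  have h32 : Nat.choose 3 2 = 3 := rfl
  have hl : #P.large = 0 ∨ #P.large = 1 ∨ #P.large = 2 ∨ #P.large = 3 ∨ 4 ≤ #P.large := by lia
  rcases hl with h | h | h | h | h
  any_goals rw [h] at hA1
  all_goals lia

lemma card_eq (hS : P.S.Nonempty) :
    Fintype.card V = 9 ∨ Fintype.card V = 13 ∨ Fintype.card V = 15 := by
  rcases lt_trichotomy #P.S 5 with h | h | h
  · exact .inl (card_eq_nine hS (by lia))
  · exact .inr (.inl (card_eq_thirteen h))
  · exact .inr (.inr (card_eq_fifteen h))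

end CriticalBarrier

/-- A critical vertex of a graph with domination number three is the only vertex not dominated by
some pair. -/
lemma GammaCritical.exists_pair {V : Type*} [Finite V] {G : SimpleGraph V}
    (h : GammaCritical G 3) (v : V) :
    ∃ x y, x ≠ y ∧ x ≠ v ∧ y ≠ v ∧ ¬ G.Adj x v ∧ ¬ G.Adj y v ∧
      ∀ w, w ≠ v → w = x ∨ w = y ∨ G.Adj x w ∨ G.Adj y w := by
  have hne : {n | ∃ D : Set V, IsDomSetAvoiding G v D ∧ D.ncard = n}.Nonempty :=
    ⟨_, {v}ᶜ, ⟨by simp, fun w hw ↦ .inl hw⟩, rfl⟩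
  obtain ⟨D, ⟨hvD, hD⟩, hcard⟩ := Nat.sInf_mem hne
  have hlt : D.ncard < 3 := hcard ▸ h.2 v
  have hmin : ∀ E : Set V, IsDomSet G E → 3 ≤ E.ncard := fun E hE ↦
    h.1 ▸ Nat.sInf_le ⟨E, hE, rfl⟩
  have hinsert : IsDomSet G (insert v D) := by
    intro w
    by_cases hw : w = v
    · exact .inl (.inl hw)
    · exact (hD w hw).imp .inr fun ⟨u, hu, huw⟩ ↦ ⟨u, .inr hu, huw⟩
  have h2 : D.ncard = 2 := by
    have := hmin _ hinsert
    rw [Set.ncard_insert_of_notMem hvD] at this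
    lia
  have hv : ∀ u ∈ D, ¬ G.Adj u v := by
    intro u hu huv
    have := hmin D fun w ↦ by
      by_cases hw : w = v
      · exact .inr ⟨u, hu, hw ▸ huv⟩
      · exact hD w hw
    lia
  obtain ⟨x, y, hxy, rfl⟩ := Set.ncard_eq_two.1 h2
  refine ⟨x, y, hxy, ?_, ?_, hv x (by simp), hv y (by simp), fun w hw ↦ ?_⟩
  · rintro rfl
    simp at hvD
  · rintro rfl
    simp at hvD
  · have := hD w hw
    simp only [Set.mem_insert_iff, Set.mem_singleton_iff, exists_eq_or_imp, exists_eq_left] at this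
    tauto

/-- The graph obtained from `G` by adding a vertex adjacent to all others. -/
def cone {V : Type*} (G : SimpleGraph V) : SimpleGraph (Option V) where
  Adj a b := a ≠ b ∧ ∀ x ∈ a, ∀ y ∈ b, G.Adj x y
  symm := ⟨fun _ _ h ↦ ⟨h.1.symm, fun x hx y hy ↦ (h.2 y hy x hx).symm⟩⟩
  loopless := ⟨fun _ h ↦ h.1 rfl⟩

lemma cone_adj_none {V : Type*} {G : SimpleGraph V} {a : Option V} (ha : a ≠ none) :
    (cone G).Adj a none := ⟨ha, by simp⟩

lemma cone_adj_some {V : Type*} {G : SimpleGraph V} {x y : V} :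
    (cone G).Adj (some x) (some y) ↔ G.Adj x y := by
  simpa [cone] using fun h ↦ h.ne

lemma hasNearPerfectMatching_of_cone {V : Type*} {G : SimpleGraph V}
    {M : (cone G).Subgraph} (hM : M.IsPerfectMatching) : HasNearPerfectMatching G := by
  rw [Subgraph.isPerfectMatching_iff] at hM
  obtain ⟨a, ha, ha'⟩ := hM none
  obtain ⟨v, rfl⟩ := Option.ne_none_iff_exists'.1 ha.ne.symm
  refine ⟨{
    verts := {v}ᶜ
    Adj := fun x y ↦ M.Adj (some x) (some y)
    adj_sub := fun h ↦ cone_adj_some.1 h.adj_sub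
    edge_vert := ?_
    symm := ⟨fun _ _ h ↦ h.symm⟩ }, v, ?_, rfl⟩
  · rintro x y h rfl
    have := (hM (some x)).unique h ha.symm
    simp at this
  · intro x hx
    obtain ⟨b, hb, hb'⟩ := hM (some x)
    cases b with
    | none => exact (hx (Option.some_injective _ (ha' _ hb.symm))).elim
    | some y => exact ⟨y, hb, fun z hz ↦ Option.some_injective _ (hb' _ hz)⟩

/-- The Berge formula for a graph of odd order, in the case of no near perfect matching. -/
lemma exists_barrier.{u} {V : Type u} [Fintype V] {G : SimpleGraph V} (hodd : Odd (Fintype.card V))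
    (h : ¬ HasNearPerfectMatching G) :
    ∃ (S : Finset V) (κ : Type u) (cls : V → Option κ) (T : Finset κ), #T = #S + 2 ∧
      (∀ v ∉ S, cls v ∈ insertNone T) ∧ (∀ c ∈ T, Odd #{v | v ∉ S ∧ cls v = some c}) ∧
      ∀ u v, u ∉ S → v ∉ S → G.Adj u v → cls u = cls v := by
  obtain ⟨U, hU⟩ : ∃ U, (cone G).IsTutteViolator U := by
    by_contra! hU
    obtain ⟨M, hM⟩ := tutte.2 hU
    exact h (hasNearPerfectMatching_of_cone hM)
  rw [IsTutteViolator] at hU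
  set H := ((⊤ : (cone G).Subgraph).deleteVerts U).coe with hH
  have hverts : ∀ a : Option V, a ∈ ((⊤ : (cone G).Subgraph).deleteVerts U).verts ↔ a ∉ U := by
    simp
  have hadj : ∀ a b, H.Adj a b ↔ (cone G).Adj a.1 b.1 := by
    rintro ⟨a, ha⟩ ⟨b, hb⟩
    rw [hverts] at ha hb
    simp [hH, ha, hb]
  have hnone : none ∈ U := by
    by_contra hnone
    have hcomp : ∀ c : H.ConnectedComponent,
        c = H.connectedComponentMk ⟨none, (hverts _).2 hnone⟩ := by
      intro c
      induction c using ConnectedComponent.ind with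
      | _ a =>
        by_cases ha : a.1 = none
        · exact congrArg _ (Subtype.ext ha)
        · exact ConnectedComponent.eq.2 ((hadj _ _).2 (cone_adj_none ha)).reachable
    have : Subsingleton H.ConnectedComponent := ⟨fun c d ↦ (hcomp c).trans (hcomp d).symm⟩
    have h1 : H.oddComponents.ncard ≤ 1 := Set.ncard_le_one_of_subsingleton _
    have h2 : H.oddComponents.ncard = 1 := by lia
    have h3 := H.odd_ncard_oddComponents.1 (by simp [h2])
    have hU0 : U = ∅ := (Set.ncard_eq_zero (Set.toFinite _)).1 (by lia)
    subst hU0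
    rw [Nat.card_coe_set_eq, Subgraph.deleteVerts_verts, Subgraph.verts_top, Set.sdiff_empty,
      Set.ncard_univ, Nat.card_eq_fintype_card, Fintype.card_option] at h3
    exact (Nat.odd_add_one.1 h3) hodd
  set S : Finset V := {v | some v ∈ U} with hS
  have hcardU : U.ncard = #S + 1 := by
    have : U = (insertNone S : Finset (Option V)) := by
      ext a
      cases a <;> simp [hS, hnone]
    rw [this, Set.ncard_coe_finset, card_insertNone]
  obtain ⟨T, hT, hTcard⟩ : ∃ T : Finset H.ConnectedComponent, ↑T ⊆ H.oddComponents ∧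
      #T = #S + 2 := by
    rw [← Set.coe_toFinset H.oddComponents, Set.ncard_coe_finset] at hU
    obtain ⟨T, hT, hTcard⟩ := exists_subset_card_eq (s := H.oddComponents.toFinset) (n := #S + 2)
      (by lia)
    exact ⟨T, fun c hc ↦ by simpa using hT hc, hTcard⟩
  have hSU : ∀ v, v ∉ S ↔ some v ∈ ((⊤ : (cone G).Subgraph).deleteVerts U).verts := by
    simp [hS]
  let cls : V → Option H.ConnectedComponent := fun v ↦
    if hv : v ∉ S then
      if H.connectedComponentMk ⟨some v, (hSU v).1 hv⟩ ∈ T then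
        some (H.connectedComponentMk ⟨some v, (hSU v).1 hv⟩)
      else none
    else none
  have hcls : ∀ v (hv : v ∉ S), ∀ c ∈ T,
      (cls v = some c ↔ H.connectedComponentMk ⟨some v, (hSU v).1 hv⟩ = c) := by
    intro v hv c hc
    simp only [cls, dif_pos hv]
    split_ifs with h'
    · simp
    · simp only [false_iff]
      rintro rfl
      exact h' hc
  refine ⟨S, H.ConnectedComponent, cls, T, hTcard, ?_, ?_, ?_⟩
  · intro v hv
    simp only [cls, dif_pos hv]
    split_ifs with h' <;> simp [h']
  · intro c hc
    have hco : Odd c.supp.ncard := hT hc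
    convert hco
    rw [← Set.ncard_coe_finset]
    refine Set.ncard_congr (fun v hv ↦ ⟨some v, (hSU v).1 (mem_filter.1 (mem_coe.1 hv)).2.1⟩)
      ?_ ?_ ?_
    · intro v hv
      have hv := (mem_filter.1 (mem_coe.1 hv)).2
      exact (hcls v hv.1 c hc).1 hv.2
    · intro v w _ _ hvw
      exact Option.some_injective _ (congrArg Subtype.val hvw)
    · rintro ⟨_ | v, hv⟩ hvc
      · exact ((hverts _).1 hv hnone).elim
      · have hvS := (hSU v).2 hv
        exact ⟨v, by simpa using ⟨hvS, (hcls v hvS c hc).2 hvc⟩, rfl⟩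
  · intro u v hu hv huv
    have : H.connectedComponentMk ⟨some u, (hSU u).1 hu⟩ =
        H.connectedComponentMk ⟨some v, (hSU v).1 hv⟩ :=
      ConnectedComponent.eq.2 ((hadj _ _).2 (cone_adj_some.2 huv)).reachable
    simp only [cls, dif_pos hu, dif_pos hv, this]

/-- A union of connected components with an odd number of vertices includes an odd component. -/
lemma exists_odd_component {V : Type*} [Fintype V] {H : SimpleGraph V} {p : V → Prop}
    (hp : ∀ u v, H.Adj u v → (p u ↔ p v)) (hodd : Odd #{v | p v}) :
    ∃ k : H.ConnectedComponent, Odd k.supp.ncard ∧ ∀ v, H.connectedComponentMk v = k → p v := by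
  have hreach : ∀ u v, H.Reachable u v → (p u ↔ p v) := by
    rintro u v ⟨w⟩
    induction w with
    | nil => rfl
    | cons h _ ih => exact (hp _ _ h).trans ih
  by_contra! hk
  rw [← Nat.not_even_iff_odd] at hodd
  refine hodd ?_
  rw [card_eq_sum_card_fiberwise (f := H.connectedComponentMk) (t := univ) (by simp)]
  refine even_sum _ fun k _ ↦ ?_
  by_cases hodd' : Odd k.supp.ncard
  · obtain ⟨v, rfl, hv⟩ := hk k hodd'
    rw [card_eq_zero.2]
    · simp
    · refine filter_eq_empty_iff.2 fun u hu huv ↦ hv ?_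
      exact (hreach _ _ (ConnectedComponent.eq.1 huv)).1 (mem_filter.1 hu).2
  · by_cases hv : ∃ v, p v ∧ H.connectedComponentMk v = k
    · obtain ⟨v, hv, rfl⟩ := hv
      rw [Nat.not_odd_iff_even] at hodd'
      refine (congrArg Even ?_).mpr hodd'
      rw [← Set.ncard_coe_finset]
      congr 1
      ext u
      simp only [coe_filter, mem_filter, mem_univ, true_and, Set.mem_ofPred_eq,
        ConnectedComponent.mem_supp_iff, and_iff_right_iff_imp]
      exact fun h ↦ (hreach _ _ (ConnectedComponent.eq.1 h)).2 hv
    · push Not at hv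
      rw [card_eq_zero.2]
      · simp
      · exact filter_eq_empty_iff.2 fun u hu huv ↦ hv u (mem_filter.1 hu).2 huv

lemma exists_adj_of_numOddComponents_eq_one {V κ : Type*} [Fintype V] {G : SimpleGraph V}
    (hco : numOddComponents G ∅ = 1) {cls : V → κ} {c d : κ} (hcd : c ≠ d)
    (hc : Odd #{v | cls v = c}) (hd : Odd #{v | cls v = d}) :
    ∃ u v, G.Adj u v ∧ cls u ≠ cls v := by
  by_contra! hadj
  have key : ∀ c, Odd #{v | cls v = c} → ∃ k : (G.induce (∅ : Set V)ᶜ).ConnectedComponent,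
      Odd k.supp.ncard ∧ ∀ v, connectedComponentMk _ v = k → cls v.1 = c := by
    intro c hc
    refine exists_odd_component (p := fun v : ↥(∅ : Set V)ᶜ ↦ cls v.1 = c)
      (fun u v h ↦ by simp only [hadj _ _ (induce_adj.1 h)]) ?_
    convert hc
    refine card_bij (fun v _ ↦ v.1) (by simp) (fun _ _ _ _ ↦ Subtype.ext) fun v hv ↦ ?_
    exact ⟨⟨v, by simp⟩, by simpa using hv, rfl⟩
  obtain ⟨k, hk, hk'⟩ := key c hc
  obtain ⟨l, hl, hl'⟩ := key d hd
  have := (Nat.card_eq_one_iff_unique.1 hco).1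
  have hkl : k = l := congrArg Subtype.val (this.elim ⟨k, hk⟩ ⟨l, hl⟩)
  subst hkl
  obtain ⟨v, hv⟩ := k.exists_rep
  exact hcd ((hk' v hv).symm.trans (hl' v hv))

lemma odd_card_fiber_none {V κ : Type*} [Fintype V] (hodd : Odd (Fintype.card V)) {S : Finset V}
    {cls : V → Option κ} {T : Finset κ} (hT : #T = #S + 2)
    (hcls : ∀ v ∉ S, cls v ∈ insertNone T)
    (hoddT : ∀ c ∈ T, Odd #{v | v ∉ S ∧ cls v = some c}) :
    Odd #{v | v ∉ S ∧ cls v = none} := by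
  have h1 : #(univ \ S) = ∑ c ∈ insertNone T, #{v | v ∉ S ∧ cls v = c} := by
    rw [card_eq_sum_card_fiberwise (f := cls) (t := insertNone T)
      fun v hv ↦ hcls v (by simpa using hv)]
    refine sum_congr rfl fun c _ ↦ congrArg _ ?_
    ext v
    simp
  have h2 : #(univ \ S) + #S = Fintype.card V := by
    rw [card_sdiff_add_card_eq_card (subset_univ S), card_univ]
  have h3 : Odd (∑ c ∈ T, #{v | v ∉ S ∧ cls v = some c}) ↔ Odd #T := by
    rw [odd_sum_iff_odd_card_odd, filter_true_of_mem hoddT]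
  rw [sum_insertNone] at h1
  rw [hT] at h3
  rw [← h2, h1] at hodd
  grind

/-- A critical graph of odd order without near perfect matching, with one odd component, has a
nonempty barrier. -/
lemma exists_criticalBarrier.{u} {V : Type u} [Fintype V] {G : SimpleGraph V}
    (hcrit : GammaCritical G 3) (hodd : Odd (Fintype.card V)) (hco : numOddComponents G ∅ = 1)
    (hfree : StarFree G 7) (h : ¬ HasNearPerfectMatching G) :
    ∃ (κ : Type u) (P : CriticalBarrier G κ), P.S.Nonempty := by
  obtain ⟨S, κ, cls, T, hT, hcls, hoddT, hadj⟩ := exists_barrier hodd h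
  have hoddT' : ∀ c ∈ insertNone T, Odd #{v | v ∉ S ∧ cls v = c} := by
    rintro (_ | c) hc
    · exact odd_card_fiber_none hodd hT hcls hoddT
    · exact hoddT c (some_mem_insertNone.1 hc)
  have hT' : #(insertNone T) = #S + 3 := by rw [card_insertNone, hT]
  have hS : S.Nonempty := by
    rw [nonempty_iff_ne_empty]
    rintro rfl
    obtain ⟨c, hc, d, hd, hcd⟩ := one_lt_card.1 (show 1 < #(insertNone T) by simp [hT'])
    obtain ⟨u, v, huv, hne⟩ := exists_adj_of_numOddComponents_eq_one (cls := cls) hco hcd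
      (by convert hoddT' c hc; simp) (by convert hoddT' d hd; simp)
    exact hne (hadj u v (by simp) (by simp) huv)
  have hpair : ∀ v, ∃ x y, x ∈ S ∧ x ≠ y ∧ x ≠ v ∧ y ≠ v ∧ ¬ G.Adj x v ∧ ¬ G.Adj y v ∧
      ∀ w, w ≠ v → w = x ∨ w = y ∨ G.Adj x w ∨ G.Adj y w := by
    intro v
    obtain ⟨x, y, hxy, hx, hy, hx', hy', hdom⟩ := hcrit.exists_pair v
    by_cases hxS : x ∈ S
    · exact ⟨x, y, hxS, hxy, hx, hy, hx', hy', hdom⟩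
    by_cases hyS : y ∈ S
    · exact ⟨y, x, hyS, hxy.symm, hy, hx, hy', hx', fun w hw ↦ by have := hdom w hw; tauto⟩
    exfalso
    have hsub : insertNone T ⊆ {cls v, cls x, cls y} := by
      intro c hc
      obtain ⟨w, hw⟩ := card_pos.1 (hoddT' c hc).pos
      obtain ⟨hwS, rfl⟩ := (mem_filter.1 hw).2
      simp only [mem_insert, mem_singleton]
      by_cases hwv : w = v
      · exact .inl (by rw [hwv])
      rcases hdom w hwv with rfl | rfl | h | h
      · simp
      · simp
      · exact .inr (.inl (hadj _ _ hxS hwS h).symm)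
      · exact .inr (.inr (hadj _ _ hyS hwS h).symm)
    have := (card_le_card hsub).trans card_le_three
    have := card_pos.2 hS
    lia
  choose X Y hXS hXY hX hY hX' hY' hdom using hpair
  exact ⟨_, ⟨S, cls, insertNone T, hcls, fun c hc ↦ by convert hoddT' c hc, hadj, hT', X, Y, hXS,
    hXY, hX, hY, hX', hY', hdom, hfree⟩, hS⟩

end

/-- A `3`-`γ`-vertex-critical `K_{1,7}`-free graph of odd order with
`c_o(G) = 1` and `|V(G)| ≠ 13` has a near perfect matching, unless `|V(G)| = 9`
or `|V(G)| = 15`. -/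
theorem three_gamma_critical_K17_free_odd_nearPerfectMatching
    {V : Type*} [Fintype V] (G : SimpleGraph V)
    (hcrit : GammaCritical G 3) (hodd : Odd (Fintype.card V))
    (hco : numOddComponents G (∅ : Set V) = 1)
    (h13 : Fintype.card V ≠ 13) (hfree : StarFree G 7) :
    HasNearPerfectMatching G ∨ Fintype.card V = 9 ∨ Fintype.card V = 15 := by
  by_contra! h
  obtain ⟨κ, P, hS⟩ := exists_criticalBarrier hcrit hodd hco hfree h.1
  have := P.card_eq hS
  tauto
end

section
/- A graph G is 2-γ-vertex-critical if and only if G is isomorphic to a complete graph K_{2n} (n ≥ 1) with a perfect matching removed. -/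
open SimpleGraph

theorem domNum_le {V : Type*} {G : SimpleGraph V} {D : Set V} (h : IsDomSet G D) :
    domNum G ≤ D.ncard :=
  Nat.sInf_le ⟨D, h, rfl⟩

theorem exists_isDomSet_ncard_eq_domNum {V : Type*} (G : SimpleGraph V) :
    ∃ D : Set V, IsDomSet G D ∧ D.ncard = domNum G :=
  Nat.sInf_mem (s := {n | ∃ D : Set V, IsDomSet G D ∧ D.ncard = n})
    ⟨_, Set.univ, fun _ => Or.inl trivial, rfl⟩

theorem domNumDel_le {V : Type*} {G : SimpleGraph V} {x : V} {D : Set V}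
    (h : IsDomSetAvoiding G x D) : domNumDel G x ≤ D.ncard :=
  Nat.sInf_le ⟨D, h, rfl⟩

theorem exists_isDomSetAvoiding_ncard_eq_domNumDel {V : Type*} (G : SimpleGraph V) (x : V) :
    ∃ D : Set V, IsDomSetAvoiding G x D ∧ D.ncard = domNumDel G x :=
  Nat.sInf_mem (s := {n | ∃ D : Set V, IsDomSetAvoiding G x D ∧ D.ncard = n})
    ⟨_, {x}ᶜ, ⟨by simp, fun _ hv => Or.inl hv⟩, rfl⟩

theorem Function.Involutive.even_card {V : Type*} [Fintype V] {f : V → V}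
    (hf : Function.Involutive f) (hne : ∀ x, f x ≠ x) : Even (Fintype.card V) := by
  have h : ∏ _x : V, (-1 : ℤ) = 1 :=
    Finset.prod_involution (fun x _ => f x) (fun _ _ => by norm_num) (fun x _ _ => hne x)
      (fun _ _ => Finset.mem_univ _) (fun x _ => hf x)
  rw [Finset.prod_const, Finset.card_univ] at h
  exact (neg_one_pow_eq_one_iff_even (by norm_num)).1 h

/-- In a `2`-`γ`-vertex-critical graph, each vertex `v` has a partner whose only non-neighbour
other than itself is `v`. -/
theorem GammaCritical.exists_partner {V : Type*} [Finite V] {G : SimpleGraph V}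
    (h : GammaCritical G 2) (v : V) :
    ∃ u, u ≠ v ∧ ¬ G.Adj u v ∧ ∀ w, w ≠ u → w ≠ v → G.Adj u w := by
  have not_dom (x : V) : ¬ IsDomSet G {x} := fun hx => by
    have := domNum_le hx
    rw [h.1, Set.ncard_singleton] at this
    omega
  obtain ⟨D, ⟨hvD, hD⟩, hcard⟩ := exists_isDomSetAvoiding_ncard_eq_domNumDel G v
  have hle : D.ncard ≤ 1 := by have := h.2 v; omega
  rcases Nat.le_one_iff_eq_zero_or_eq_one.1 hle with h0 | h1
  · rw [Set.ncard_eq_zero] at h0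
    subst h0
    refine absurd (fun w => Or.inl ?_) (not_dom v)
    by_contra hw
    simpa using hD w hw
  · obtain ⟨u, rfl⟩ := Set.ncard_eq_one.1 h1
    have huw : ∀ w, w ≠ u → w ≠ v → G.Adj u w := fun w hwu hwv => by
      simpa [hwu] using hD w hwv
    refine ⟨u, fun huv => hvD huv.symm, fun huv => not_dom u fun w => ?_, huw⟩
    by_cases hwu : w = u
    · exact Or.inl hwu
    · refine Or.inr ⟨u, rfl, ?_⟩
      by_cases hwv : w = v
      · exact hwv ▸ huv
      · exact huw w hwu hwv

/-- Brigham, Chinn, Dutton: a graph is `2`-`γ`-vertex-critical iff it is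
(isomorphic to) a complete graph of even positive order with a perfect matching removed,
i.e. there is a fixed-point-free involution `f` pairing up the vertices such that
`x` and `y` are adjacent exactly when `x ≠ y` and `y ≠ f x`. -/
theorem two_gamma_critical_iff_complete_minus_perfectMatching
    {V : Type*} [Fintype V] (G : SimpleGraph V) :
    GammaCritical G 2 ↔
      Nonempty V ∧ Even (Fintype.card V) ∧
        ∃ f : V → V, Function.Involutive f ∧ (∀ x, f x ≠ x) ∧
          ∀ x y, G.Adj x y ↔ x ≠ y ∧ y ≠ f x := by
  constructor
  · intro h
    choose f hne hnadj hadj using h.exists_partner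
    have hf : Function.Involutive f := fun x => by
      by_contra hx
      exact hnadj (f x) (hadj x _ (hne _) hx).symm
    refine ⟨?_, hf.even_card hne, f, hf, hne, fun x y => ⟨fun hxy => ⟨hxy.ne, ?_⟩, ?_⟩⟩
    · obtain ⟨D, -, hD⟩ := exists_isDomSet_ncard_eq_domNum G
      rw [h.1] at hD
      obtain ⟨x, -⟩ := Set.nonempty_of_ncard_ne_zero (s := D) (by omega)
      exact ⟨x⟩
    · rintro rfl
      exact hnadj x hxy.symm
    · rintro ⟨hxy, hy⟩
      have := hadj (f x) y
      rw [hf x] at this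
      exact this hxy.symm hy
  · rintro ⟨⟨x⟩, -, f, hf, hne, hadj⟩
    refine ⟨le_antisymm ?_ ?_, fun v => ?_⟩
    · have hdom : IsDomSet G {x, f x} := fun v => by
        by_cases hv : v ∈ ({x, f x} : Set V)
        · exact Or.inl hv
        · simp only [Set.mem_insert_iff, Set.mem_singleton_iff, not_or] at hv
          exact Or.inr ⟨x, by simp, (hadj x v).2 ⟨Ne.symm hv.1, hv.2⟩⟩
      exact (domNum_le hdom).trans (Set.ncard_pair (hne x).symm).le
    · obtain ⟨D, hD, hcard⟩ := exists_isDomSet_ncard_eq_domNum G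
      by_contra! hlt
      rcases Nat.le_one_iff_eq_zero_or_eq_one.1 (by omega : D.ncard ≤ 1) with h0 | h1
      · rw [Set.ncard_eq_zero] at h0
        subst h0
        simpa using hD x
      · obtain ⟨u, rfl⟩ := Set.ncard_eq_one.1 h1
        simpa [hne u, hadj] using hD (f u)
    · have hdom : IsDomSetAvoiding G v {f v} := by
        refine ⟨(hne v).symm, fun w hw => ?_⟩
        by_cases hwf : w = f v
        · exact Or.inl hwf
        · exact Or.inr ⟨f v, rfl, (hadj _ _).2 ⟨Ne.symm hwf, by rwa [hf v]⟩⟩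
      have := domNumDel_le hdom
      rw [Set.ncard_singleton] at this
      omega
end
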